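/- arXiv:0712.4151 — 3 statements merged into one kernel-verified Lean document; each statement's English description precedes it below -/
import Mathlib

section
/- The following eight claims (each a universal statement over all cubic 3-connected graphs G) are pairwise equivalent: (z1) if v(G) ≡ 0 (mod 6) then G has a Λ-factor; (z2) if v(G) ≡ 0 (mod 6) then for every edge e of G there is a Λ-factor of G avoiding e; (z3) if v(G) ≡ 0 (mod 6) then for every edge e of G there is a Λ-factor of G containing e; (z4) if v(G) ≡ 0 (mod 6) then G − X has a Λ-factor for every set X of two edges of G; (z5) if v(G) ≡ 0 (mod 6) then G − L has a Λ-factor for every 3-vertex path L in G (where G − L deletes the vertices of L); (t2) if v(G) ≡ 2 (mod 6) then G − {x,y} has a Λ-factor for every edge xy of G; (f1) if v(G) ≡ 4 (mod 6) then G − x has a Λ-factor for every vertex x of G; (f2) if v(G) ≡ 4 (mod 6) then (G − x) − e has a Λ-factor for every vertex x and every edge e of G (with e not incident to x). -/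
open SimpleGraph

/-- `p` encodes a 3-vertex path (a `Λ`) in `G`: three distinct vertices, the first
adjacent to the second and the second adjacent to the third. -/
def IsPathL {V : Type*} (G : SimpleGraph V) (p : V × V × V) : Prop :=
  p.1 ≠ p.2.1 ∧ p.2.1 ≠ p.2.2 ∧ p.1 ≠ p.2.2 ∧ G.Adj p.1 p.2.1 ∧ G.Adj p.2.1 p.2.2

/-- The vertex set of an encoded 3-vertex path. -/
def pVerts {V : Type*} (p : V × V × V) : Set V := {p.1, p.2.1, p.2.2}

/-- The edge set of an encoded 3-vertex path. -/
def pEdges {V : Type*} (p : V × V × V) : Set (Sym2 V) := {s(p.1, p.2.1), s(p.2.1, p.2.2)}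

/-- A `Λ`-packing of `G`: a collection of pairwise vertex-disjoint 3-vertex paths of `G`. -/
def IsPacking {V : Type*} (G : SimpleGraph V) (P : Finset (V × V × V)) : Prop :=
  (∀ p ∈ P, IsPathL G p) ∧
  ∀ p ∈ P, ∀ q ∈ P, p ≠ q → Disjoint (pVerts p) (pVerts q)

/-- A `Λ`-factor of the induced subgraph of `G` on the vertex set `S`:
a `Λ`-packing whose paths lie in `S` and together cover all of `S`. -/
def IsFactorOn {V : Type*} (G : SimpleGraph V) (S : Set V) (P : Finset (V × V × V)) : Prop :=
  IsPacking G P ∧ (∀ p ∈ P, pVerts p ⊆ S) ∧ ∀ v ∈ S, ∃ p ∈ P, v ∈ pVerts p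

/-- A `Λ`-factor of `G`. -/
def IsFactor {V : Type*} (G : SimpleGraph V) (P : Finset (V × V × V)) : Prop :=
  IsFactorOn G Set.univ P

/-- The packing `P` contains the edge `e`. -/
def PContains {V : Type*} (P : Finset (V × V × V)) (e : Sym2 V) : Prop :=
  ∃ p ∈ P, e ∈ pEdges p

/-- `λ(G)`: the maximum number of pairwise disjoint 3-vertex paths in `G`. -/
noncomputable def lambdaNum {V : Type*} (G : SimpleGraph V) [Fintype V] : ℕ :=
  sSup {n | ∃ P : Finset (V × V × V), IsPacking G P ∧ P.card = n}

/-- Every vertex of `G` has degree exactly 3. -/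
def IsCubic {V : Type*} (G : SimpleGraph V) : Prop :=
  ∀ v, (G.neighborSet v).ncard = 3

/-- `G` is `k`-connected: more than `k` vertices, and deleting any set of fewer than
`k` vertices leaves a connected graph. -/
def KConnected {V : Type*} (k : ℕ) (G : SimpleGraph V) [Fintype V] : Prop :=
  k < Fintype.card V ∧ ∀ S : Set V, S.ncard < k → (G.induce Sᶜ).Connected

/-- (z1): every cubic 3-connected graph with `v(G) ≡ 0 (mod 6)` has a `Λ`-factor. -/
def ClaimZ1 : Prop := ∀ (n : ℕ) (G : SimpleGraph (Fin n)),
  IsCubic G → KConnected 3 G → n % 6 = 0 → ∃ P, IsFactor G P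

/-- (z2): ... for every edge `e` there is a `Λ`-factor avoiding `e`. -/
def ClaimZ2 : Prop := ∀ (n : ℕ) (G : SimpleGraph (Fin n)),
  IsCubic G → KConnected 3 G → n % 6 = 0 →
  ∀ e ∈ G.edgeSet, ∃ P, IsFactor G P ∧ ¬ PContains P e

/-- (z3): ... for every edge `e` there is a `Λ`-factor containing `e`. -/
def ClaimZ3 : Prop := ∀ (n : ℕ) (G : SimpleGraph (Fin n)),
  IsCubic G → KConnected 3 G → n % 6 = 0 →
  ∀ e ∈ G.edgeSet, ∃ P, IsFactor G P ∧ PContains P e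

/-- (z4): ... `G − X` has a `Λ`-factor for every set `X` of two edges. -/
def ClaimZ4 : Prop := ∀ (n : ℕ) (G : SimpleGraph (Fin n)),
  IsCubic G → KConnected 3 G → n % 6 = 0 →
  ∀ X : Finset (Sym2 (Fin n)), ↑X ⊆ G.edgeSet → X.card = 2 →
    ∃ P, IsFactor (G.deleteEdges ↑X) P

/-- (z5): ... `G − L` has a `Λ`-factor for every 3-vertex path `L` of `G`. -/
def ClaimZ5 : Prop := ∀ (n : ℕ) (G : SimpleGraph (Fin n)),
  IsCubic G → KConnected 3 G → n % 6 = 0 →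
  ∀ L : Fin n × Fin n × Fin n, IsPathL G L → ∃ P, IsFactorOn G (pVerts L)ᶜ P

/-- (t2): every cubic 3-connected graph with `v(G) ≡ 2 (mod 6)`: `G − {x,y}` has a
`Λ`-factor for every edge `xy`. -/
def ClaimT2 : Prop := ∀ (n : ℕ) (G : SimpleGraph (Fin n)),
  IsCubic G → KConnected 3 G → n % 6 = 2 →
  ∀ x y : Fin n, G.Adj x y → ∃ P, IsFactorOn G ({x, y} : Set (Fin n))ᶜ P

/-- (f1): every cubic 3-connected graph with `v(G) ≡ 4 (mod 6)`: `G − x` has a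
`Λ`-factor for every vertex `x`. -/
def ClaimF1 : Prop := ∀ (n : ℕ) (G : SimpleGraph (Fin n)),
  IsCubic G → KConnected 3 G → n % 6 = 4 →
  ∀ x : Fin n, ∃ P, IsFactorOn G ({x} : Set (Fin n))ᶜ P

/-- (f2): every cubic 3-connected graph with `v(G) ≡ 4 (mod 6)`: `(G − x) − e` has a
`Λ`-factor for every vertex `x` and edge `e` not incident to `x`. -/
def ClaimF2 : Prop := ∀ (n : ℕ) (G : SimpleGraph (Fin n)),
  IsCubic G → KConnected 3 G → n % 6 = 4 →
  ∀ x : Fin n, ∀ e ∈ G.edgeSet, x ∉ e →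
    ∃ P, IsFactorOn (G.deleteEdges {e}) ({x} : Set (Fin n))ᶜ P

/-! ### Packings and factors -/

/-- The induced subgraph of `G` on `S` has a `Λ`-factor. -/
def HasFactor {V : Type*} (G : SimpleGraph V) (S : Set V) : Prop :=
  ∃ P, IsFactorOn G S P

theorem IsFactorOn.mono {V : Type*} {G G' : SimpleGraph V} {S : Set V}
    {P : Finset (V × V × V)} (h : G ≤ G') (hP : IsFactorOn G S P) : IsFactorOn G' S P := by
  obtain ⟨⟨h1, h2⟩, h3⟩ := hP
  refine ⟨⟨fun p hp => ?_, h2⟩, h3⟩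
  obtain ⟨a, b, c, d, e⟩ := h1 p hp
  exact ⟨a, b, c, h d, h e⟩

/-- The map on encoded paths induced by a map of vertices. -/
def pMap {V V' : Type*} (f : V → V') (p : V × V × V) : V' × V' × V' := (f p.1, f p.2.1, f p.2.2)

theorem pMap_injective {V V' : Type*} {f : V → V'} (hf : f.Injective) : (pMap f).Injective := by
  rintro ⟨a, b, c⟩ ⟨a', b', c'⟩ h
  simp only [pMap, Prod.mk.injEq] at h
  simp [hf h.1, hf h.2.1, hf h.2.2]

theorem pVerts_pMap {V V' : Type*} (f : V → V') (p : V × V × V) :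
    pVerts (pMap f p) = f '' pVerts p := by
  simp [pVerts, pMap, Set.image_insert_eq]

theorem HasFactor.image {V V' : Type*} {G : SimpleGraph V} {G' : SimpleGraph V'} {f : V → V'}
    (hf : f.Injective) {S : Set V} (hadj : ∀ u v, G.Adj u v → G'.Adj (f u) (f v))
    (hS : HasFactor G S) : HasFactor G' (f '' S) := by
  classical
  obtain ⟨P, ⟨h1, h2⟩, h3, h4⟩ := hS
  refine ⟨P.image (pMap f), ⟨?_, ?_⟩, ?_, ?_⟩
  · simp only [Finset.mem_image, forall_exists_index, and_imp]
    rintro _ p hp rfl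
    obtain ⟨a, b, c, d, e⟩ := h1 p hp
    exact ⟨hf.ne a, hf.ne b, hf.ne c, hadj _ _ d, hadj _ _ e⟩
  · simp only [Finset.mem_image, forall_exists_index, and_imp]
    rintro _ p hp rfl _ q hq rfl hpq
    rw [pVerts_pMap, pVerts_pMap]
    exact Set.disjoint_image_of_injective hf (h2 p hp q hq (fun h => hpq (by rw [h])))
  · simp only [Finset.mem_image, forall_exists_index, and_imp]
    rintro _ p hp rfl
    rw [pVerts_pMap]
    exact Set.image_mono (h3 p hp)
  · rintro _ ⟨v, hv, rfl⟩
    obtain ⟨p, hp, hvp⟩ := h4 v hv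
    exact ⟨pMap f p, Finset.mem_image_of_mem _ hp, by rw [pVerts_pMap]; exact ⟨v, hvp, rfl⟩⟩

theorem HasFactor.of_image {V V' : Type*} {G : SimpleGraph V} {G' : SimpleGraph V'} {f : V → V'}
    (hf : f.Injective) {S : Set V} (hadj : ∀ u v, G'.Adj (f u) (f v) → G.Adj u v)
    (hS : HasFactor G' (f '' S)) : HasFactor G S := by
  classical
  obtain ⟨P, ⟨h1, h2⟩, h3, h4⟩ := hS
  refine ⟨P.preimage (pMap f) (pMap_injective hf).injOn, ⟨?_, ?_⟩, ?_, ?_⟩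
  · intro p hp
    obtain ⟨a, b, c, d, e⟩ := h1 _ (Finset.mem_preimage.1 hp)
    exact ⟨fun h => a (congrArg f h), fun h => b (congrArg f h), fun h => c (congrArg f h),
      hadj _ _ d, hadj _ _ e⟩
  · intro p hp q hq hpq
    have := h2 _ (Finset.mem_preimage.1 hp) _ (Finset.mem_preimage.1 hq)
      ((pMap_injective hf).ne hpq)
    rw [pVerts_pMap, pVerts_pMap] at this
    exact Set.disjoint_image_iff hf |>.1 this
  · intro p hp
    have := h3 _ (Finset.mem_preimage.1 hp)
    rw [pVerts_pMap] at this
    exact (Set.image_subset_image_iff hf).1 this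
  · intro v hv
    obtain ⟨p, hp, hvp⟩ := h4 (f v) ⟨v, hv, rfl⟩
    have hsub := h3 p hp
    obtain ⟨a, b, c⟩ := p
    obtain ⟨a', -, rfl⟩ := hsub (show a ∈ _ by simp [pVerts])
    obtain ⟨b', -, rfl⟩ := hsub (show b ∈ _ by simp [pVerts])
    obtain ⟨c', -, rfl⟩ := hsub (show c ∈ _ by simp [pVerts])
    refine ⟨(a', b', c'), Finset.mem_preimage.2 hp, ?_⟩
    have : f v ∈ f '' pVerts (a', b', c') := by rw [← pVerts_pMap]; exact hvp
    exact (hf.mem_set_image).1 this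

/-- A union of members of a factor inherits a factor. -/
theorem IsFactorOn.restrict {V : Type*} {G : SimpleGraph V} {S T : Set V}
    {P : Finset (V × V × V)} (hP : IsFactorOn G S P) (hT : T ⊆ S)
    (h : ∀ p ∈ P, ∀ v ∈ pVerts p, v ∈ T → pVerts p ⊆ T) : HasFactor G T := by
  classical
  obtain ⟨⟨h1, h2⟩, h3, h4⟩ := hP
  refine ⟨P.filter (fun p => pVerts p ⊆ T), ⟨?_, ?_⟩, ?_, ?_⟩
  · exact fun p hp => h1 p (Finset.mem_filter.1 hp).1
  · exact fun p hp q hq => h2 p (Finset.mem_filter.1 hp).1 q (Finset.mem_filter.1 hq).1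
  · exact fun p hp => (Finset.mem_filter.1 hp).2
  · intro v hv
    obtain ⟨p, hp, hvp⟩ := h4 v (hT hv)
    exact ⟨p, Finset.mem_filter.2 ⟨hp, h p hp v hvp hv⟩, hvp⟩

theorem IsFactorOn.insert {V : Type*} [DecidableEq V] {G : SimpleGraph V} {S : Set V}
    {P : Finset (V × V × V)} (hP : IsFactorOn G S P) {L : V × V × V} (hL : IsPathL G L)
    (hd : Disjoint (pVerts L) S) : IsFactorOn G (pVerts L ∪ S) (insert L P) := by
  obtain ⟨⟨h1, h2⟩, h3, h4⟩ := hP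
  refine ⟨⟨?_, ?_⟩, ?_, ?_⟩
  · intro p hp
    rcases Finset.mem_insert.1 hp with rfl | hp
    exacts [hL, h1 p hp]
  · intro p hp q hq hpq
    rcases Finset.mem_insert.1 hp with hp' | hp' <;> rcases Finset.mem_insert.1 hq with hq' | hq'
    · exact absurd (hp'.trans hq'.symm) hpq
    · exact hp' ▸ hd.mono_right (h3 q hq')
    · exact hq' ▸ (hd.mono_right (h3 p hp')).symm
    · exact h2 p hp' q hq' hpq
  · intro p hp
    rcases Finset.mem_insert.1 hp with rfl | hp
    exacts [Set.subset_union_left, (h3 p hp).trans Set.subset_union_right]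
  · rintro v (hv | hv)
    · exact ⟨L, Finset.mem_insert_self _ _, hv⟩
    · obtain ⟨p, hp, hvp⟩ := h4 v hv
      exact ⟨p, Finset.mem_insert_of_mem hp, hvp⟩

theorem HasFactor.union_path {V : Type*} {G : SimpleGraph V} {S : Set V} (hS : HasFactor G S)
    {L : V × V × V} (hL : IsPathL G L) (hd : Disjoint (pVerts L) S) :
    HasFactor G (pVerts L ∪ S) := by
  classical
  exact hS.elim fun _ hP => ⟨_, hP.insert hL hd⟩

theorem HasFactor.three_dvd {V : Type*} {G : SimpleGraph V} {S : Set V} (hS : HasFactor G S) :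
    3 ∣ S.ncard := by
  classical
  obtain ⟨P, ⟨h1, h2⟩, h3, h4⟩ := hS
  have key : S = (P.biUnion (fun p => ({p.1, p.2.1, p.2.2} : Finset V)) : Finset V) := by
    ext v
    simp only [Finset.coe_biUnion, Finset.mem_coe, Set.mem_iUnion, Finset.coe_insert,
      Finset.coe_singleton]
    constructor
    · intro hv
      obtain ⟨p, hp, hvp⟩ := h4 v hv
      exact ⟨p, hp, hvp⟩
    · rintro ⟨p, hp, hvp⟩
      exact h3 p hp hvp
  rw [key, Set.ncard_coe_finset, Finset.card_biUnion]
  · apply Finset.dvd_sum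
    intro p hp
    obtain ⟨a, b, c, -, -⟩ := h1 p hp
    rw [Finset.card_eq_three.2 ⟨_, _, _, a, c, b, rfl⟩]
  · intro p hp q hq hpq
    have := h2 p hp q hq hpq
    rw [Function.onFun, ← Finset.disjoint_coe]
    simpa [pVerts] using this

/-! ### Connectivity avoiding a set of vertices -/

/-- `u` and `v` are joined in `G` by a walk all of whose steps avoid `D`. -/
def Linked {V : Type*} (G : SimpleGraph V) (D : Set V) : V → V → Prop :=
  Relation.ReflTransGen fun a b => G.Adj a b ∧ a ∉ D ∧ b ∉ D

namespace Linked

theorem symm {V : Type*} {G : SimpleGraph V} {D : Set V} {u v : V} (h : Linked G D u v) :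
    Linked G D v u := by
  induction h with
  | refl => exact .refl
  | tail _ h ih => exact .head ⟨h.1.symm, h.2.2, h.2.1⟩ ih

theorem trans {V : Type*} {G : SimpleGraph V} {D : Set V} {u v w : V} (h : Linked G D u v)
    (h' : Linked G D v w) : Linked G D u w :=
  Relation.ReflTransGen.trans h h'

theorem of_adj {V : Type*} {G : SimpleGraph V} {D : Set V} {u v : V} (h : G.Adj u v)
    (hu : u ∉ D) (hv : v ∉ D) : Linked G D u v :=
  .single ⟨h, hu, hv⟩

/-- Transport along a map, each step being replaced by a connection. -/
theorem lift {V V' : Type*} {G : SimpleGraph V} {G' : SimpleGraph V'} {D : Set V} {D' : Set V'}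
    (f : V → V')
    (hf : ∀ a b, G.Adj a b → a ∉ D → b ∉ D → Linked G' D' (f a) (f b)) {u v : V}
    (h : Linked G D u v) : Linked G' D' (f u) (f v) := by
  induction h with
  | refl => exact .refl
  | tail _ h ih => exact ih.trans (hf _ _ h.1 h.2.1 h.2.2)

theorem mono {V : Type*} {G : SimpleGraph V} {D D' : Set V} (hD : D' ⊆ D) {u v : V}
    (h : Linked G D u v) : Linked G D' u v :=
  h.lift id fun _ _ h ha hb => of_adj h (fun h => ha (hD h)) (fun h => hb (hD h))

/-- A walk to `a` yields a walk to a neighbour of `a` that does not meet `a`. -/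
theorem exists_adj {V : Type*} {G : SimpleGraph V} {D : Set V} {u a : V} (h : Linked G D u a)
    (hu : u ≠ a) : ∃ v, G.Adj v a ∧ v ∉ D ∧ Linked G (insert a D) u v := by
  induction h using Relation.ReflTransGen.head_induction_on with
  | refl => exact absurd rfl hu
  | @head b c hbc _ ih =>
    by_cases hc : c = a
    · subst hc
      exact ⟨b, hbc.1, hbc.2.1, .refl⟩
    · obtain ⟨v, h1, h2, h3⟩ := ih hc
      refine ⟨v, h1, h2, (of_adj hbc.1 ?_ ?_).trans h3⟩
      · rintro (h | h)
        exacts [hu h, hbc.2.1 h]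
      · rintro (h | h)
        exacts [hc h, hbc.2.2 h]

end Linked

theorem reachable_induce_iff {V : Type*} {G : SimpleGraph V} {D : Set V} {u v : V} (hu : u ∉ D)
    (hv : v ∉ D) :
    (G.induce Dᶜ).Reachable ⟨u, hu⟩ ⟨v, hv⟩ ↔ Linked G D u v := by
  rw [SimpleGraph.reachable_iff_reflTransGen]
  constructor
  · have key : ∀ a b : (Dᶜ : Set V), Relation.ReflTransGen (G.induce Dᶜ).Adj a b →
        Linked G D a b := by
      intro a b h
      induction h with
      | refl => exact .refl
      | @tail b c _ h ih => exact ih.tail ⟨h, b.2, c.2⟩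
    exact key _ _
  · intro h
    induction h with
    | refl => exact .refl
    | tail _ h ih => exact (ih h.2.1).tail h.1

theorem KConnected.linked {V : Type*} [Fintype V] {G : SimpleGraph V} (h : KConnected 3 G)
    {D : Set V} (hD : D.ncard < 3) {u v : V} (hu : u ∉ D) (hv : v ∉ D) : Linked G D u v :=
  (reachable_induce_iff hu hv).1 ((h.2 D hD).preconnected _ _)

theorem KConnected.linked_pair {V : Type*} [Fintype V] {G : SimpleGraph V} (h : KConnected 3 G)
    {p q u v : V} (hu : u ≠ p) (hu' : u ≠ q) (hv : v ≠ p) (hv' : v ≠ q) :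
    Linked G {p, q} u v :=
  h.linked (((Set.ncard_insert_le p {q}).trans (by simp)).trans_lt (by norm_num : 2 < 3))
    (by simp [hu, hu']) (by simp [hv, hv'])

theorem kConnected_three_of_pair {V : Type*} [Fintype V] {G : SimpleGraph V}
    (hc : 3 < Fintype.card V)
    (h : ∀ p q u v : V, u ≠ p → u ≠ q → v ≠ p → v ≠ q → Linked G {p, q} u v) :
    KConnected 3 G := by
  classical
  refine ⟨hc, fun D hD => ?_⟩
  have key : ∀ u v, u ∉ D → v ∉ D → Linked G D u v := by
    intro u v hu hv
    obtain h0 | h1 | h2 : D.ncard = 0 ∨ D.ncard = 1 ∨ D.ncard = 2 := by omega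
    · obtain rfl := (Set.ncard_eq_zero).1 h0
      obtain ⟨p, hp⟩ : ∃ p, p ∉ ({u, v} : Finset V) := by
        by_contra! hall
        have : Fintype.card V ≤ ({u, v} : Finset V).card :=
          Finset.card_le_card fun x _ => hall x
        have := Finset.card_le_two (a := u) (b := v)
        omega
      simp only [Finset.mem_insert, Finset.mem_singleton, not_or] at hp
      exact (h p p u v (Ne.symm hp.1) (Ne.symm hp.1) (Ne.symm hp.2) (Ne.symm hp.2)).mono
        (Set.empty_subset _)
    · obtain ⟨p, rfl⟩ := Set.ncard_eq_one.1 h1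
      simp only [Set.mem_singleton_iff] at hu hv
      simpa using h p p u v hu hu hv hv
    · obtain ⟨p, q, -, rfl⟩ := Set.ncard_eq_two.1 h2
      simp only [Set.mem_insert_iff, Set.mem_singleton_iff, not_or] at hu hv
      exact h p q u v hu.1 hu.2 hv.1 hv.2
  have : Nonempty (Dᶜ : Set V) := by
    by_contra hne
    have : D = Set.univ := by
      ext x
      simp only [Set.mem_univ, iff_true]
      by_contra hx
      exact hne ⟨x, hx⟩
    rw [this, Set.ncard_univ, Nat.card_eq_fintype_card] at hD
    omega
  exact ⟨fun u v => (reachable_induce_iff u.2 v.2).2 (key _ _ u.2 v.2)⟩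

/-! ### Transport to arbitrary finite vertex types -/

theorem IsCubic.comap_equiv {V V' : Type*} {G : SimpleGraph V} (hG : IsCubic G) (e : V' ≃ V) :
    IsCubic (G.comap e) := by
  intro v
  rw [← hG (e v), ← Set.ncard_image_of_injective _ e.injective]
  congr 1
  ext w
  constructor
  · rintro ⟨w, hw, rfl⟩
    exact hw
  · intro hw
    exact ⟨e.symm w, by simpa using hw, by simp⟩

theorem KConnected.comap_equiv {V V' : Type*} [Fintype V] [Fintype V'] {G : SimpleGraph V}
    (hG : KConnected 3 G) (e : V' ≃ V) : KConnected 3 (G.comap e) := by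
  refine kConnected_three_of_pair (by rw [Fintype.card_congr e]; exact hG.1) ?_
  intro p q u v h1 h2 h3 h4
  have h := hG.linked_pair (e.injective.ne h1) (e.injective.ne h2) (e.injective.ne h3)
    (e.injective.ne h4)
  have h' : Linked (G.comap e) {p, q} (e.symm (e u)) (e.symm (e v)) := by
    refine h.lift e.symm fun a b hab ha hb => .of_adj (by simpa using hab) ?_ ?_
    · simpa [Equiv.symm_apply_eq] using ha
    · simpa [Equiv.symm_apply_eq] using hb
  simpa using h'

theorem HasFactor.of_equiv {V V' : Type*} {G : SimpleGraph V} {G' : SimpleGraph V'} (e : V' ≃ V)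
    {S : Set V} {T : Set V'} (h : HasFactor G' T) (hadj : ∀ u v, G'.Adj u v → G.Adj (e u) (e v))
    (hT : ∀ v, v ∈ T ↔ e v ∈ S) : HasFactor G S := by
  obtain rfl : T = e ⁻¹' S := Set.ext hT
  have := h.image e.injective hadj
  rwa [Set.image_preimage_eq _ e.surjective] at this

section Transport

variable {V : Type} [Fintype V] {G : SimpleGraph V}

theorem ClaimZ1.hasFactor (h : ClaimZ1) (hc : IsCubic G) (hk : KConnected 3 G)
    (hn : Fintype.card V % 6 = 0) : HasFactor G Set.univ := by
  let e := (Fintype.equivFin V).symm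
  exact HasFactor.of_equiv e (h _ _ (hc.comap_equiv e) (hk.comap_equiv e) hn) (fun _ _ h => h)
    (by simp)

theorem ClaimF1.hasFactor (h : ClaimF1) (hc : IsCubic G) (hk : KConnected 3 G)
    (hn : Fintype.card V % 6 = 4) (x : V) : HasFactor G {x}ᶜ := by
  let e := (Fintype.equivFin V).symm
  exact HasFactor.of_equiv e (h _ _ (hc.comap_equiv e) (hk.comap_equiv e) hn (e.symm x))
    (fun _ _ h => h) (by simp [Equiv.eq_symm_apply])

theorem ClaimT2.hasFactor (h : ClaimT2) (hc : IsCubic G) (hk : KConnected 3 G)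
    (hn : Fintype.card V % 6 = 2) {x y : V} (hxy : G.Adj x y) : HasFactor G {x, y}ᶜ := by
  let e := (Fintype.equivFin V).symm
  exact HasFactor.of_equiv e (h _ _ (hc.comap_equiv e) (hk.comap_equiv e) hn (e.symm x)
    (e.symm y) (by simpa using hxy)) (fun _ _ h => h) (by simp [Equiv.eq_symm_apply])

theorem ClaimZ5.hasFactor (h : ClaimZ5) (hc : IsCubic G) (hk : KConnected 3 G)
    (hn : Fintype.card V % 6 = 0) {L : V × V × V} (hL : IsPathL G L) :
    HasFactor G (pVerts L)ᶜ := by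
  let e := (Fintype.equivFin V).symm
  exact HasFactor.of_equiv e (h _ _ (hc.comap_equiv e) (hk.comap_equiv e) hn (pMap e.symm L)
    (by simpa [IsPathL, pMap] using hL)) (fun _ _ h => h)
    (by simp [pVerts, pMap, Equiv.eq_symm_apply])

theorem ClaimF2.hasFactor (h : ClaimF2) (hc : IsCubic G) (hk : KConnected 3 G)
    (hn : Fintype.card V % 6 = 4) {x a b : V} (hab : G.Adj a b) (ha : x ≠ a) (hb : x ≠ b) :
    HasFactor (G.deleteEdges {s(a, b)}) {x}ᶜ := by
  let e := (Fintype.equivFin V).symm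
  exact HasFactor.of_equiv e (h _ _ (hc.comap_equiv e) (hk.comap_equiv e) hn (e.symm x)
    s(e.symm a, e.symm b) (by simpa using hab) (by simp [ha, hb]))
    (by simp [Equiv.eq_symm_apply]) (by simp [Equiv.eq_symm_apply])

end Transport

/-! ### Frames: substituting pieces into a bipartite graph -/

/-- A graph `H` to be substituted for a vertex of a bipartite graph; the edge towards `z` is
attached at `x z`. -/
structure Piece (Z : Type) where
  /-- The vertices of the piece. -/
  U : Type
  /-- There are finitely many vertices. -/
  fin : Fintype U
  /-- The graph on the piece. -/
  H : SimpleGraph U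
  /-- The attachment vertices. -/
  x : Z → U

instance {Z : Type} (p : Piece Z) : Fintype p.U := p.fin

/-- The conditions under which a piece attached to the vertices in `J` may be substituted for a
vertex, keeping the graph cubic and 3-connected. -/
structure Piece.Good {Z : Type} (p : Piece Z) (J : Z → Prop) : Prop where
  deg : ∀ u, (p.H.neighborSet u).ncard + {z | J z ∧ p.x z = u}.ncard = 3
  linked : ∀ u v, Linked p.H ∅ u v
  exit : ∀ (D : Set p.U) (E : Set Z), D.ncard + E.ncard ≤ 2 → ∀ u ∉ D,
    ∃ z, J z ∧ z ∉ E ∧ p.x z ∉ D ∧ Linked p.H D u (p.x z)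

variable {W Z : Type}

/-- The adjacency relation of `frame`. -/
inductive FrameAdj (I : W → Z → Prop) (P : W → Piece Z) :
    Z ⊕ (Σ w, (P w).U) → Z ⊕ (Σ w, (P w).U) → Prop
  | out {w z} : I w z → FrameAdj I P (.inl z) (.inr ⟨w, (P w).x z⟩)
  | into {w z} : I w z → FrameAdj I P (.inr ⟨w, (P w).x z⟩) (.inl z)
  | inner {w u v} : (P w).H.Adj u v → FrameAdj I P (.inr ⟨w, u⟩) (.inr ⟨w, v⟩)

/-- The graph obtained from the bipartite graph on `Z ⊕ W` with incidence `I` by substituting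
the piece `P w` for each vertex `w`. -/
def frame (I : W → Z → Prop) (P : W → Piece Z) : SimpleGraph (Z ⊕ (Σ w, (P w).U)) where
  Adj := FrameAdj I P
  symm := ⟨fun a b h => by
    cases h with
    | out h => exact .into h
    | into h => exact .out h
    | inner h => exact .inner h.symm⟩
  loopless := ⟨fun a h => by
    cases h with
    | inner h => exact h.ne rfl⟩

section Frame

variable {I : W → Z → Prop} {P : W → Piece Z}

theorem frame_adj_inl_inr {z : Z} {w : W} {u : (P w).U} :
    (frame I P).Adj (.inl z) (.inr ⟨w, u⟩) ↔ I w z ∧ (P w).x z = u := by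
  constructor
  · intro h
    cases h with
    | out h => exact ⟨h, rfl⟩
  · rintro ⟨h, rfl⟩
    exact .out h

theorem frame_adj_inr_inl {z : Z} {w : W} {u : (P w).U} :
    (frame I P).Adj (.inr ⟨w, u⟩) (.inl z) ↔ I w z ∧ (P w).x z = u := by
  rw [SimpleGraph.adj_comm, frame_adj_inl_inr]

theorem not_frame_adj_inl_inl {z z' : Z} : ¬ (frame I P).Adj (.inl z) (.inl z') := by
  intro h
  cases h

theorem frame_adj_inr_inr {w : W} {u v : (P w).U} :
    (frame I P).Adj (.inr ⟨w, u⟩) (.inr ⟨w, v⟩) ↔ (P w).H.Adj u v := by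
  constructor
  · intro h
    cases h with
    | inner h => exact h
  · exact .inner

theorem eq_of_frame_adj {w w' : W} {u : (P w).U} {v : (P w').U}
    (h : (frame I P).Adj (.inr ⟨w, u⟩) (.inr ⟨w', v⟩)) : w = w' := by
  cases h
  rfl

theorem inr_mk_injective (w : W) :
    (fun u : (P w).U => (.inr ⟨w, u⟩ : Z ⊕ (Σ w, (P w).U))).Injective := by
  intro u v h
  simpa using h

theorem frame_isCubic [Fintype W] [Fintype Z] (hz : ∀ z, {w | I w z}.ncard = 3)
    (hP : ∀ w, (P w).Good (I w)) : IsCubic (frame I P) := by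
  rintro (z | ⟨w, u⟩)
  · rw [← hz z, ← Set.ncard_image_of_injective (f := fun w =>
      (.inr ⟨w, (P w).x z⟩ : Z ⊕ (Σ w, (P w).U)))]
    · congr 1
      ext (z' | ⟨w, u⟩)
      · simp [not_frame_adj_inl_inl]
      · simp only [mem_neighborSet, frame_adj_inl_inr, Set.mem_image, Set.mem_ofPred_eq]
        constructor
        · rintro ⟨h, rfl⟩
          exact ⟨w, h, rfl⟩
        · rintro ⟨w', h, heq⟩
          cases heq
          exact ⟨h, rfl⟩
    · intro w w' h
      simp only [Sum.inr.injEq, Sigma.mk.injEq] at h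
      exact h.1
  · rw [← (hP w).deg u, ← Set.ncard_image_of_injective _ (inr_mk_injective (Z := Z) w),
      ← Set.ncard_image_of_injective (f := fun z => (.inl z : Z ⊕ (Σ w, (P w).U))) _
        Sum.inl_injective, ← Set.ncard_union_eq]
    · congr 1
      ext (z' | ⟨w', u'⟩)
      · simp [frame_adj_inr_inl]
      · simp only [mem_neighborSet, Set.mem_union, Set.mem_image, reduceCtorEq, and_false,
          exists_false, or_false, Sum.inr.injEq]
        constructor
        · intro h
          obtain rfl := eq_of_frame_adj h
          exact ⟨u', frame_adj_inr_inr.1 h, rfl⟩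
        · rintro ⟨v, hv, heq⟩
          cases heq
          exact frame_adj_inr_inr.2 hv
    · rw [Set.disjoint_left]
      rintro _ ⟨a, -, rfl⟩ ⟨b, -, h⟩
      cases h

theorem frame_kConnected [Fintype W] [Fintype Z] (hcard : 3 ≤ Fintype.card Z)
    (hZ : Nonempty W)
    (hI : ∀ t t' : Z ⊕ W, ∀ z z', .inl z ≠ t → .inl z ≠ t' → .inl z' ≠ t → .inl z' ≠ t' →
      ∃ z'', .inl z'' ≠ t ∧ .inl z'' ≠ t' ∧ (∃ w, .inr w ≠ t ∧ .inr w ≠ t' ∧ I w z ∧ I w z'') ∧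
        ∃ w, .inr w ≠ t ∧ .inr w ≠ t' ∧ I w z'' ∧ I w z')
    (hP : ∀ w, (P w).Good (I w)) : KConnected 3 (frame I P) := by
  refine kConnected_three_of_pair ?_ ?_
  · obtain ⟨w⟩ := hZ
    have : Nonempty Z := Fintype.card_pos_iff.1 (by omega)
    have : Nonempty (Σ w, (P w).U) := ⟨⟨w, (P w).x (Classical.arbitrary Z)⟩⟩
    rw [Fintype.card_sum]
    have := Fintype.card_pos (α := Σ w, (P w).U)
    omega
  intro d d' u v hu hu' hv hv'
  let π : Z ⊕ (Σ w, (P w).U) → Z ⊕ W := Sum.map id Sigma.fst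
  have hnr : ∀ {w}, .inr w ≠ π d → .inr w ≠ π d' → ∀ u, .inr ⟨w, u⟩ ∉ ({d, d'} : Set _) := by
    rintro w h h' u (rfl | rfl)
    exacts [h rfl, h' rfl]
  have hnl : ∀ {z}, .inl z ∉ ({d, d'} : Set _) → .inl z ≠ π d ∧ .inl z ≠ π d' := by
    intro z hz
    constructor
    · intro h
      rcases d with z' | ⟨w, u⟩
      · cases h
        exact hz (.inl rfl)
      · cases h
    · intro h
      rcases d' with z' | ⟨w, u⟩
      · cases h
        exact hz (.inr rfl)
      · cases h
  have hnl' : ∀ {z}, .inl z ≠ π d → .inl z ≠ π d' → .inl z ∉ ({d, d'} : Set _) := by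
    rintro z h h' (rfl | rfl)
    exacts [h rfl, h' rfl]
  have across : ∀ {z z' w}, .inl z ∉ ({d, d'} : Set _) → .inl z' ∉ ({d, d'} : Set _) →
      .inr w ≠ π d → .inr w ≠ π d' → I w z → I w z' →
      Linked (frame I P) {d, d'} (.inl z) (.inl z') := by
    intro z z' w hz hz' h h' hI hI'
    refine (Linked.of_adj (FrameAdj.out hI) hz (hnr h h' _)).trans (.trans ?_
      (.of_adj (FrameAdj.into hI') (hnr h h' _) hz'))
    exact ((hP w).linked ((P w).x z) ((P w).x z')).lift
      (fun u => (.inr ⟨w, u⟩ : Z ⊕ (Σ w, (P w).U))) fun a b hab _ _ =>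
        .of_adj (FrameAdj.inner hab) (hnr h h' _) (hnr h h' _)
  have hZZ : ∀ {z z'}, .inl z ∉ ({d, d'} : Set _) → .inl z' ∉ ({d, d'} : Set _) →
      Linked (frame I P) {d, d'} (.inl z) (.inl z') := by
    intro z z' hz hz'
    obtain ⟨z'', h1, h2, ⟨w, h3, h4, h7, h8⟩, ⟨w', h5, h6, h9, h10⟩⟩ :=
      hI (π d) (π d') z z' (hnl hz).1 (hnl hz).2 (hnl hz').1 (hnl hz').2
    exact (across hz (hnl' h1 h2) h3 h4 h7 h8).trans (across (hnl' h1 h2) hz' h5 h6 h9 h10)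
  have hexit : ∀ u, u ∉ ({d, d'} : Set _) → ∃ z, .inl z ∉ ({d, d'} : Set _) ∧
      Linked (frame I P) {d, d'} u (.inl z) := by
    rintro (z | ⟨w, u⟩) hu
    · exact ⟨z, hu, .refl⟩
    obtain ⟨z, h1, h2, h3, h4⟩ := (hP w).exit {u | (.inr ⟨w, u⟩ : Z ⊕ (Σ w, (P w).U)) ∈ ({d, d'} : Set _)}
      {z | (.inl z : Z ⊕ (Σ w, (P w).U)) ∈ ({d, d'} : Set _)} (by
        rw [← Set.ncard_image_of_injective _ (inr_mk_injective (Z := Z) w),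
          ← Set.ncard_image_of_injective (f := fun z => (.inl z : Z ⊕ (Σ w, (P w).U))) _
            Sum.inl_injective, ← Set.ncard_union_eq]
        · refine (Set.ncard_le_ncard (t := {d, d'}) ?_).trans
            ((Set.ncard_insert_le _ _).trans (by simp))
          rintro _ (⟨u, h, rfl⟩ | ⟨z, h, rfl⟩)
          exacts [h, h]
        · rw [Set.disjoint_left]
          rintro _ ⟨a, -, rfl⟩ ⟨b, -, h⟩
          cases h) u hu
    refine ⟨z, h2, .trans (h4.lift (fun u => (.inr ⟨w, u⟩ : Z ⊕ (Σ w, (P w).U)))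
      fun a b hab ha hb => .of_adj (FrameAdj.inner hab) ha hb) (.of_adj (FrameAdj.into h1) h3 h2)⟩
  obtain ⟨z, hz, huz⟩ := hexit u (by simp [hu, hu'])
  obtain ⟨z', hz', hvz⟩ := hexit v (by simp [hv, hv'])
  exact huz.trans ((hZZ hz hz').trans hvz.symm)

end Frame

/-! ### Admissible pieces -/

/-- The one-vertex piece. -/
def pointPiece (Z : Type) : Piece Z where
  U := Unit
  fin := inferInstance
  H := ⊥
  x := fun _ => ()

theorem exists_mem_notMem_of_ncard [Finite Z] {J E : Set Z} (hJ : J.ncard = 3)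
    (hE : E.ncard ≤ 2) : ∃ z ∈ J, z ∉ E :=
  Set.exists_mem_notMem_of_ncard_lt_ncard (by omega)

theorem pointPiece_good [Finite Z] {J : Z → Prop} (hJ : {z | J z}.ncard = 3) :
    (pointPiece Z).Good J where
  deg u := by
    have h1 : (pointPiece Z).H.neighborSet u = ∅ :=
      Set.eq_empty_of_forall_notMem fun v hv => (bot_adj u v).1 hv
    have h2 : {z | J z ∧ (pointPiece Z).x z = u} = {z | J z} := by
      ext z
      exact and_iff_left rfl
    rw [h1, h2, hJ, Set.ncard_empty]
  linked u v := .refl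
  exit D E hDE u hu := by
    obtain ⟨z, hz, hzE⟩ := exists_mem_notMem_of_ncard hJ (by omega : E.ncard ≤ 2)
    exact ⟨z, hz, hzE, hu, .refl⟩

/-- The piece obtained from `A` by deleting the vertex `a`. -/
noncomputable def pieceOf {V : Type} [Fintype V] (A : SimpleGraph V) (a : V) (x : Z → {v // v ≠ a}) :
    Piece Z where
  U := {v // v ≠ a}
  fin := Fintype.ofFinite _
  H := A.comap Subtype.val
  x := x

/-- `x` restricts to a bijection from `J` to the set of neighbours of `a`. -/
structure Attach {V : Type} (A : SimpleGraph V) (a : V) (J : Z → Prop) (x : Z → {v // v ≠ a}) :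
    Prop where
  adj : ∀ z, J z → A.Adj a (x z)
  inj : ∀ z z', J z → J z' → x z = x z' → z = z'
  surj : ∀ v, A.Adj a v → ∃ z, J z ∧ (x z : V) = v

theorem Attach.good {V : Type} [Fintype V] [Finite Z] {A : SimpleGraph V} {a : V} {J : Z → Prop}
    {x : Z → {v // v ≠ a}} (hJ : {z | J z}.ncard = 3) (hx : Attach A a J x) (hA : IsCubic A)
    (hk : KConnected 3 A) : (pieceOf A a x).Good J where
  deg := by
    intro (u : {v // v ≠ a})
    change ((A.comap (Subtype.val : {v // v ≠ a} → V)).neighborSet u).ncard +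
      {z | J z ∧ x z = u}.ncard = 3
    rw [← hA u, ← Set.ncard_image_of_injective _ Subtype.val_injective]
    by_cases hau : A.Adj a u
    · obtain ⟨z, hz, hzu⟩ := hx.surj _ hau
      have h1 : {z | J z ∧ x z = u} = {z} := by
        ext z'
        constructor
        · rintro ⟨h, h'⟩
          exact hx.inj _ _ h hz (h'.trans (Subtype.ext hzu.symm))
        · rintro rfl
          exact ⟨hz, Subtype.ext hzu⟩
      rw [h1, Set.ncard_singleton, ← Set.ncard_insert_of_notMem (a := a)]
      · congr 1
        ext v
        constructor
        · rintro (rfl | ⟨v, hv, rfl⟩)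
          exacts [hau.symm, hv]
        · intro hv
          by_cases hva : v = a
          exacts [.inl hva, .inr ⟨⟨v, hva⟩, hv, rfl⟩]
      · rintro ⟨v, -, h⟩
        exact v.2 h
    · have h1 : {z | J z ∧ x z = u} = ∅ := by
        ext z'
        simp only [Set.mem_ofPred_eq, Set.mem_empty_iff_false, iff_false, not_and]
        rintro h rfl
        exact hau (hx.adj _ h)
      rw [h1, Set.ncard_empty, add_zero]
      congr 1
      ext v
      constructor
      · rintro ⟨v, hv, rfl⟩
        exact hv
      · intro hv
        refine ⟨⟨v, ?_⟩, hv, rfl⟩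
        rintro rfl
        exact hau hv.symm
  linked := by
    intro (u : {v // v ≠ a}) (v : {v // v ≠ a})
    have h := hk.linked_pair u.2 u.2 v.2 v.2
    have key : ∀ w, Linked A {a, a} u w → ∀ hw : w ≠ a,
        Linked (A.comap (Subtype.val : {v // v ≠ a} → V)) ∅ u ⟨w, hw⟩ := by
      intro w h
      induction h with
      | refl => exact fun _ => .refl
      | tail _ h ih =>
        intro hw
        exact (ih (fun hb => h.2.1 (.inl hb))).tail ⟨h.1, id, id⟩
    exact key _ h v.2
  exit := by
    intro (D : Set {v // v ≠ a}) E hDE (u : {v // v ≠ a}) hu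
    have key : ∀ w, Linked A (insert a (Subtype.val '' D)) u w → ∀ hw : w ≠ a,
        Linked (A.comap (Subtype.val : {v // v ≠ a} → V)) D u ⟨w, hw⟩ := by
      intro w h
      induction h with
      | refl => exact fun _ => .refl
      | tail _ h ih =>
        intro hw
        refine (ih (fun hb => h.2.1 (.inl hb))).tail ⟨h.1, ?_, ?_⟩
        · exact fun h' => h.2.1 (.inr ⟨_, h', rfl⟩)
        · exact fun h' => h.2.2 (.inr ⟨_, h', rfl⟩)
    have hD : (Subtype.val '' D).ncard = D.ncard :=
      Set.ncard_image_of_injective _ Subtype.val_injective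
    have hu' : (u : V) ∉ Subtype.val '' D := by
      rintro ⟨w, hw, h⟩
      exact hu (Subtype.ext h ▸ hw)
    by_cases hE : D.ncard ≤ 1
    · obtain ⟨z, hz, hzE⟩ : ∃ z ∈ {z | J z}, z ∉ E ∪ {z | J z ∧ x z ∈ D} := by
        refine exists_mem_notMem_of_ncard hJ ((Set.ncard_union_le _ _).trans ?_)
        have : {z | J z ∧ x z ∈ D}.ncard ≤ D.ncard :=
          Set.ncard_le_ncard_of_injOn x (fun z hz => hz.2)
            (fun z hz z' hz' h => hx.inj _ _ hz.1 hz'.1 h)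
        change D.ncard + E.ncard ≤ 2 at hDE
        omega
      have hzD : x z ∉ D := fun h => hzE (.inr ⟨hz, h⟩)
      refine ⟨z, hz, fun h => hzE (.inl h), hzD, key _ (hk.linked ?_ ?_ ?_) (x z).2⟩
      · refine (Set.ncard_insert_le _ _).trans_lt ?_
        omega
      · rintro (h | h)
        exacts [u.2 h, hu' h]
      · rintro (h | ⟨w, hw, h⟩)
        exacts [(x z).2 h, hzD (Subtype.ext h ▸ hw)]
    · have haD : a ∉ Subtype.val '' D := by
        rintro ⟨w, -, h⟩
        exact w.2 h
      change D.ncard + E.ncard ≤ 2 at hDE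
      obtain ⟨v, hv, hvD, h⟩ := (hk.linked (by omega) hu' haD).exists_adj u.2
      obtain ⟨z, hz, rfl⟩ := hx.surj v hv.symm
      refine ⟨z, hz, ?_, fun h => hvD ⟨_, h, rfl⟩, key _ h (x z).2⟩
      have hE0 : E = ∅ := by
        rw [← Set.ncard_eq_zero (s := E)]
        omega
      simp [hE0]

/-- The neighbours of a vertex of a cubic graph can be labelled by `J`, two of the labels being
prescribed. -/
theorem exists_attach {V : Type} [Fintype V] {A : SimpleGraph V} (hA : IsCubic A) {a p q : V}
    {J : Z → Prop} (hJ : {z | J z}.ncard = 3) (hp : A.Adj a p) (hq : A.Adj a q) (hpq : p ≠ q)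
    {z₁ z₂ : Z} (hz₁ : J z₁) (hz₂ : J z₂) (hz : z₁ ≠ z₂) :
    ∃ x : Z → {v // v ≠ a}, Attach A a J x ∧ (x z₁ : V) = p ∧ (x z₂ : V) = q := by
  classical
  have third : ∀ {α : Type} {s : Set α} {i j : α}, s.ncard = 3 → i ∈ s → j ∈ s → i ≠ j →
      ∃ k, s = {i, j, k} ∧ i ≠ k ∧ j ≠ k := by
    intro α s i j hs hi hj hij
    have h2 : ({i, j} : Set α).ncard < s.ncard := by
      rw [hs, Set.ncard_pair hij]
      norm_num
    obtain ⟨k, hk, hk'⟩ := Set.exists_mem_notMem_of_ncard_lt_ncard h2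
    simp only [Set.mem_insert_iff, Set.mem_singleton_iff, not_or] at hk'
    refine ⟨k, (Set.eq_of_subset_of_ncard_le ?_ ?_ (Set.finite_of_ncard_ne_zero
      (by omega))).symm, Ne.symm hk'.1, Ne.symm hk'.2⟩
    · rintro _ (rfl | rfl | rfl) <;> assumption
    · rw [hs, Set.ncard_eq_three.2 ⟨i, j, k, hij, Ne.symm hk'.1, Ne.symm hk'.2, rfl⟩]
  obtain ⟨r, hr, hpr, hqr⟩ := third (hA a) hp hq hpq
  obtain ⟨z₃, h3, h13, h23⟩ := third hJ hz₁ hz₂ hz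
  have hra : A.Adj a r := by
    change r ∈ A.neighborSet a
    simp [hr]
  have hJ' : ∀ z, J z ↔ z = z₁ ∨ z = z₂ ∨ z = z₃ := by
    intro z
    change z ∈ {z | J z} ↔ _
    simp [h3]
  refine ⟨fun z => if z = z₁ then ⟨p, hp.ne'⟩ else if z = z₂ then ⟨q, hq.ne'⟩ else ⟨r, hra.ne'⟩,
    ⟨?_, ?_, ?_⟩, ?_, ?_⟩
  · intro z _
    split_ifs <;> assumption
  · intro z z' h h' heq
    rw [hJ'] at h h'
    rcases h with rfl | rfl | rfl <;> rcases h' with rfl | rfl | rfl <;> grind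
  · intro v hv
    change v ∈ A.neighborSet a at hv
    rw [hr] at hv
    rcases hv with rfl | rfl | rfl
    · exact ⟨z₁, hz₁, by simp⟩
    · exact ⟨z₂, hz₂, by simp [Ne.symm hz]⟩
    · exact ⟨z₃, (hJ' _).2 (by simp), by simp [Ne.symm h13, Ne.symm h23]⟩
  · simp
  · simp [Ne.symm hz]

/-! ### The two frames -/

set_option maxRecDepth 100000 in
set_option synthInstance.maxHeartbeats 400000 in
set_option synthInstance.maxSize 2000 in
theorem frame_three {P : Fin 3 → Piece (Fin 3)} (hP : ∀ w, (P w).Good fun _ => True) :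
    IsCubic (frame (fun _ _ => True) P) ∧ KConnected 3 (frame (fun _ _ => True) P) := by
  refine ⟨frame_isCubic (by simp [Set.ncard_eq_toFinset_card']) hP,
    frame_kConnected (by simp) ⟨0⟩ ?_ hP⟩
  decide

set_option maxRecDepth 100000 in
set_option synthInstance.maxHeartbeats 400000 in
set_option synthInstance.maxSize 2000 in
theorem frame_four {P : Fin 4 → Piece (Fin 4)} (hP : ∀ w, (P w).Good fun z => w ≠ z) :
    IsCubic (frame (fun w z => w ≠ z) P) ∧ KConnected 3 (frame (fun w z => w ≠ z) P) := by
  refine ⟨frame_isCubic ?_ hP, frame_kConnected (by simp) ⟨0⟩ ?_ hP⟩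
  · intro z
    rw [Set.ncard_eq_toFinset_card']
    revert z
    decide
  · decide

/-! ### Factors of subgraphs of a frame -/

/-- What a factor of a frame leaves of a piece `p`: the path through `z` uses `k z` vertices of
`p`, and the remaining vertices of `T` have a factor. -/
def Outcome (p : Piece Z) (F : SimpleGraph p.U) (T : Set p.U) (adj : Z → Prop) (k : Z → ℕ) :
    Prop :=
  ∃ N : Z → Set p.U, (∀ z, (N z).ncard = k z) ∧
    (∀ z, ∀ u ∈ N z, adj z ∧ p.x z ∈ N z ∧ u ∈ T ∧ (u = p.x z ∨ F.Adj (p.x z) u)) ∧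
    HasFactor F (T \ ⋃ z, N z)

namespace Outcome

variable {p : Piece Z} {F : SimpleGraph p.U} {T : Set p.U} {adj : Z → Prop} {k : Z → ℕ}

theorem adj_of_ne_zero (h : Outcome p F T adj k) {z : Z} (hz : k z ≠ 0) : adj z := by
  obtain ⟨N, h1, h2, -⟩ := h
  rw [← h1] at hz
  obtain ⟨u, hu⟩ := Set.nonempty_of_ncard_ne_zero hz
  exact (h2 z u hu).1

/-- The number of vertices of the piece used from outside is at most `∑ z, k z`. -/
theorem exists_count [Fintype Z] (h : Outcome p F T adj k) :
    ∃ c ≤ ∑ z, k z, (c = 0 → ∀ z, k z = 0) ∧ c % 3 = T.ncard % 3 := by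
  classical
  obtain ⟨N, h1, h2, h3⟩ := h
  refine ⟨(⋃ z, N z).ncard, ?_, ?_, ?_⟩
  · have : (⋃ z, N z) = ⋃ z ∈ (Finset.univ : Finset Z), N z := by simp
    rw [this]
    refine (Finset.set_ncard_biUnion_le _ _).trans (Finset.sum_le_sum fun z _ => (h1 z).le)
  · intro hc z
    rw [Set.ncard_eq_zero] at hc
    rw [← h1, Set.ncard_eq_zero, Set.eq_empty_iff_forall_notMem]
    intro u hu
    have : u ∈ ⋃ z, N z := Set.mem_iUnion.2 ⟨z, hu⟩
    simp [hc] at this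
  · have hsub : (⋃ z, N z) ⊆ T := by
      intro u hu
      obtain ⟨z, hz⟩ := Set.mem_iUnion.1 hu
      exact (h2 z u hz).2.2.1
    have := h3.three_dvd
    have := Set.ncard_sdiff_add_ncard_of_subset hsub
    omega

theorem hasFactor_of_le_one (h : Outcome p F T adj k) (hk : ∀ z, k z ≤ 1) :
    HasFactor F (T \ {u | ∃ z, k z = 1 ∧ u = p.x z}) := by
  obtain ⟨N, h1, h2, h3⟩ := h
  have : (⋃ z, N z) = {u | ∃ z, k z = 1 ∧ u = p.x z} := by
    ext u
    rw [Set.mem_iUnion]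
    constructor
    · rintro ⟨z, hz⟩
      have hz1 : k z = 1 := by
        refine le_antisymm (hk z) ?_
        rw [← h1, Nat.one_le_iff_ne_zero]
        exact Set.ncard_ne_zero_of_mem hz
      refine ⟨z, hz1, ?_⟩
      obtain ⟨v, hv⟩ := Set.ncard_eq_one.1 ((h1 z).trans hz1)
      have hx := (h2 z u hz).2.1
      rw [hv] at hx hz
      exact hz.trans hx.symm
    · rintro ⟨z, hz, rfl⟩
      obtain ⟨v, hv⟩ := Set.ncard_eq_one.1 ((h1 z).trans hz)
      exact ⟨z, (h2 z v (hv ▸ rfl)).2.1⟩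
  rwa [this] at h3

theorem hasFactor_of_two (h : Outcome p F T adj k) {z₀ : Z} (hk : k z₀ = 2)
    (hk' : ∀ z ≠ z₀, k z = 0) : ∃ u ∈ T, u ≠ p.x z₀ ∧ adj z₀ ∧ p.x z₀ ∈ T ∧ F.Adj (p.x z₀) u ∧
      HasFactor F (T \ {p.x z₀, u}) := by
  obtain ⟨N, h1, h2, h3⟩ := h
  have hN : (⋃ z, N z) = N z₀ := by
    refine Set.Subset.antisymm (Set.iUnion_subset fun z u hu => ?_) (Set.subset_iUnion _ _)
    by_cases hz : z = z₀
    · exact hz ▸ hu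
    · have : N z = ∅ := by rw [← Set.ncard_eq_zero, h1, hk' z hz]
      simp [this] at hu
  rw [hN] at h3
  obtain ⟨v, hv⟩ := Set.nonempty_of_ncard_ne_zero (s := N z₀) (by rw [h1, hk]; norm_num)
  have hx := (h2 z₀ v hv).2.1
  obtain ⟨u, hux, hu⟩ : ∃ u, u ≠ p.x z₀ ∧ N z₀ = {p.x z₀, u} := by
    obtain ⟨a, b, hab, heq⟩ := Set.ncard_eq_two.1 ((h1 z₀).trans hk)
    rw [heq] at hx
    rcases hx with hx | hx
    · exact ⟨b, hx ▸ hab.symm, hx ▸ heq⟩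
    · exact ⟨a, hx ▸ hab, by rw [heq, hx, Set.pair_comm]⟩
  have hu' := h2 z₀ u (by simp [hu])
  exact ⟨u, hu'.2.2.1, hux, hu'.1, (h2 z₀ _ hx).2.2.1, hu'.2.2.2.resolve_left hux, hu ▸ h3⟩

end Outcome

section Analysis

variable {I : W → Z → Prop} {P : W → Piece Z} {G : SimpleGraph (Z ⊕ (Σ w, (P w).U))}

/-- A path through `z` meeting a piece contains the attachment vertex of the piece. -/
theorem path_through (hG : G ≤ frame I P) {z : Z} {w : W} {u : (P w).U}
    {p : (Z ⊕ (Σ w, (P w).U)) × (Z ⊕ (Σ w, (P w).U)) × (Z ⊕ (Σ w, (P w).U))} (hp : IsPathL G p)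
    (hz : .inl z ∈ pVerts p) (hu : .inr ⟨w, u⟩ ∈ pVerts p) :
    G.Adj (.inl z) (.inr ⟨w, (P w).x z⟩) ∧ .inr ⟨w, (P w).x z⟩ ∈ pVerts p ∧
      (u = (P w).x z ∨ G.Adj (.inr ⟨w, (P w).x z⟩) (.inr ⟨w, u⟩)) := by
  have key : ∀ b c, G.Adj (.inl z) b → G.Adj b c → (.inr ⟨w, u⟩ = b ∨ .inr ⟨w, u⟩ = c) →
      G.Adj (.inl z) (.inr ⟨w, (P w).x z⟩) ∧ .inr ⟨w, (P w).x z⟩ = b ∧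
      (u = (P w).x z ∨ G.Adj (.inr ⟨w, (P w).x z⟩) (.inr ⟨w, u⟩)) := by
    rintro (z' | ⟨w', u'⟩) c h1 h2 h
    · exact absurd (hG h1) not_frame_adj_inl_inl
    · rcases h with h | rfl
      · cases h
        obtain ⟨-, rfl⟩ := frame_adj_inl_inr.1 (hG h1)
        exact ⟨h1, rfl, .inl rfl⟩
      · obtain rfl := eq_of_frame_adj (hG h2)
        obtain ⟨-, rfl⟩ := frame_adj_inl_inr.1 (hG h1)
        exact ⟨h1, rfl, .inr h2⟩
  obtain ⟨a, b, c⟩ := p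
  obtain ⟨-, -, -, hab, hbc⟩ := hp
  dsimp only at hab hbc
  rcases hz with rfl | rfl | rfl
  · have hu' : .inr ⟨w, u⟩ = b ∨ .inr ⟨w, u⟩ = c := by
      rcases hu with h | h | h
      · cases h
      · exact .inl h
      · exact .inr h
    obtain ⟨h1, h2, h3⟩ := key _ _ hab hbc hu'
    exact ⟨h1, .inr (.inl h2), h3⟩
  · rcases hu with rfl | h | rfl
    · obtain ⟨-, rfl⟩ := frame_adj_inl_inr.1 (hG hab.symm)
      exact ⟨hab.symm, .inl rfl, .inl rfl⟩
    · cases h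
    · obtain ⟨-, rfl⟩ := frame_adj_inl_inr.1 (hG hbc)
      exact ⟨hbc, .inr (.inr rfl), .inl rfl⟩
  · have hu' : .inr ⟨w, u⟩ = b ∨ .inr ⟨w, u⟩ = a := by
      rcases hu with h | h | h
      · exact .inr h
      · exact .inl h
      · cases h
    obtain ⟨h1, h2, h3⟩ := key _ _ hbc.symm hab.symm hu'
    exact ⟨h1, .inr (.inl h2), h3⟩

theorem exists_outcome [Fintype W] [Fintype Z] (hG : G ≤ frame I P)
    {S : Set (Z ⊕ (Σ w, (P w).U))} (hS : HasFactor G S) :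
    ∃ k : W → Z → ℕ, (∀ z, ∑ w, k w z ≤ 2) ∧ (∀ z, .inl z ∉ S → ∀ w, k w z = 0) ∧
      ∀ w, Outcome (P w) (G.comap fun u => .inr ⟨w, u⟩) {u | .inr ⟨w, u⟩ ∈ S}
        (fun z => G.Adj (.inl z) (.inr ⟨w, (P w).x z⟩)) (k w) := by
  classical
  obtain ⟨Q, hQ⟩ := hS
  obtain ⟨⟨h1, h2⟩, h3, h4⟩ := id hQ
  have uniq : ∀ p ∈ Q, ∀ q ∈ Q, ∀ v, v ∈ pVerts p → v ∈ pVerts q → p = q := by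
    intro p hp q hq v hv hv'
    by_contra h
    exact Set.disjoint_left.1 (h2 p hp q hq h) hv hv'
  let N : (w : W) → Z → Set (P w).U := fun w z =>
    {u | ∃ p ∈ Q, .inl z ∈ pVerts p ∧ .inr ⟨w, u⟩ ∈ pVerts p}
  have hN : ∀ w z, .inl z ∉ S → N w z = ∅ := by
    intro w z hz
    refine Set.eq_empty_of_forall_notMem ?_
    rintro u ⟨p, hp, hzp, -⟩
    exact hz (h3 p hp hzp)
  refine ⟨fun w z => (N w z).ncard, ?_, ?_, ?_⟩
  · intro z
    by_cases hz : .inl z ∈ S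
    · obtain ⟨p, hp, hzp⟩ := h4 _ hz
      have e1 : ∑ w, (N w z).ncard =
          ((Finset.univ : Finset W).sigma fun w => (N w z).toFinset).card := by
        rw [Finset.card_sigma]
        exact Finset.sum_congr rfl fun w _ => Set.ncard_eq_toFinset_card' _
      let s : Finset (Z ⊕ (Σ w, (P w).U)) := {p.1, p.2.1, p.2.2}
      have hs : ∀ v, v ∈ s ↔ v ∈ pVerts p := by
        intro v
        simp [s, pVerts]
      have hs3 : s.card ≤ 3 := Finset.card_le_three
      have e2 := Finset.card_le_card_of_injOn (s := (Finset.univ : Finset W).sigma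
        fun w => (N w z).toFinset) (t := s.erase (.inl z)) Sum.inr (by
          rintro ⟨w, u⟩ hu
          simp only [Finset.coe_sigma, Set.mem_sigma_iff, Set.coe_toFinset] at hu
          obtain ⟨-, q, hq, hzq, huq⟩ := hu
          obtain rfl := uniq p hp q hq _ hzp hzq
          exact Finset.mem_erase.2 ⟨by simp, (hs _).2 huq⟩) Sum.inr_injective.injOn
      rw [Finset.card_erase_of_mem ((hs _).2 hzp)] at e2
      exact e1.trans_le (e2.trans (by omega))
    · simp [hN _ z hz]
  · intro z hz w
    simp [hN w z hz]
  · intro w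
    refine ⟨N w, fun z => rfl, ?_, ?_⟩
    · rintro z u ⟨p, hp, hzp, hup⟩
      obtain ⟨g1, g2, g3⟩ := path_through hG (h1 p hp) hzp hup
      exact ⟨g1, ⟨p, hp, hzp, g2⟩, h3 p hp hup, g3⟩
    · refine HasFactor.of_image (G' := G) (inr_mk_injective (Z := Z) w) (fun u v h => h) ?_
      refine hQ.restrict ?_ ?_
      · rintro _ ⟨u, ⟨hu, -⟩, rfl⟩
        exact hu
      · rintro p hp _ hv ⟨u, ⟨huS, huN⟩, rfl⟩
        have noz : ∀ z, .inl z ∉ pVerts p := fun z hz =>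
          huN (Set.mem_iUnion.2 ⟨z, p, hp, hz, hv⟩)
        have step : ∀ a b, a ∈ pVerts p → b ∈ pVerts p → G.Adj a b →
            (∃ u, a = .inr ⟨w, u⟩) → ∃ u, b = .inr ⟨w, u⟩ := by
          rintro _ (z | ⟨w', u'⟩) - hb hab ⟨u, rfl⟩
          · exact absurd hb (noz z)
          · obtain rfl := eq_of_frame_adj (hG hab)
            exact ⟨u', rfl⟩
        have all : ∀ v ∈ pVerts p, ∃ u, v = .inr ⟨w, u⟩ := by
          obtain ⟨a, b, c⟩ := p
          obtain ⟨-, -, -, hab, hbc⟩ := h1 _ hp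
          dsimp only at hab hbc
          have ha : a ∈ pVerts (a, b, c) := .inl rfl
          have hb : b ∈ pVerts (a, b, c) := .inr (.inl rfl)
          have hc : c ∈ pVerts (a, b, c) := .inr (.inr rfl)
          have hb' : ∃ u, b = .inr ⟨w, u⟩ := by
            rcases hv with h | h | h
            · exact step a b ha hb hab ⟨u, h.symm⟩
            · exact ⟨u, h.symm⟩
            · exact step c b hc hb hbc.symm ⟨u, h.symm⟩
          rintro v (rfl | rfl | rfl)
          exacts [step _ _ hb ha hab.symm hb', hb', step _ _ hb hc hbc hb']
        intro v hv'
        obtain ⟨u', rfl⟩ := all v hv'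
        refine ⟨u', ⟨h3 p hp hv', ?_⟩, rfl⟩
        intro h
        obtain ⟨z, q, hq, hz, hu'⟩ := Set.mem_iUnion.1 h
        obtain rfl := uniq p hp q hq _ hv' hu'
        exact noz z hz

end Analysis

/-! ### Reading off factors of the original graphs -/

theorem card_pieceOf {V : Type} [Fintype V] (A : SimpleGraph V) (a : V) (x : Z → {v // v ≠ a}) :
    Nat.card (pieceOf A a x).U = Fintype.card V - 1 := by
  classical
  change Nat.card {v // v ≠ a} = _
  rw [Nat.card_eq_fintype_card]
  simp

theorem card_frame_vertices [Fintype W] [Fintype Z] (P : W → Piece Z) :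
    Fintype.card (Z ⊕ (Σ w, (P w).U)) = Fintype.card Z + ∑ w, Nat.card (P w).U := by
  simp [Fintype.card_sum, Fintype.card_sigma, Nat.card_eq_fintype_card]

theorem Outcome.exists_count_univ [Fintype Z] {p : Piece Z} {F : SimpleGraph p.U} {T : Set p.U}
    {adj : Z → Prop} {k : Z → ℕ} (h : Outcome p F T adj k) (hT : ∀ u, u ∈ T) :
    ∃ c ≤ ∑ z, k z, (c = 0 → ∀ z, k z = 0) ∧ c % 3 = Nat.card p.U % 3 := by
  have := h.exists_count
  rwa [Set.eq_univ_of_forall hT, Set.ncard_univ] at this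

theorem HasFactor.of_subtype_ne {V : Type} {A' : SimpleGraph V} {a : V} {F : SimpleGraph {v // v ≠ a}} {T : Set {v // v ≠ a}}
    (h : HasFactor F T) (hF : ∀ u v, F.Adj u v → A'.Adj u v) {S : Set V}
    (hS : ∀ v, v ∈ S ↔ ∃ hv : v ≠ a, ⟨v, hv⟩ ∈ T) : HasFactor A' S := by
  have := h.image Subtype.val_injective hF
  convert this using 1
  ext v
  rw [hS]
  constructor
  · rintro ⟨hv, hT⟩
    exact ⟨_, hT, rfl⟩
  · rintro ⟨⟨v, hv⟩, hT, rfl⟩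
    exact ⟨hv, hT⟩

section PieceOf

variable {V : Type} [Fintype V] {A A' : SimpleGraph V} {a : V} {x : Z → {v // v ≠ a}}
  {F : SimpleGraph (pieceOf A a x).U} {T : Set (pieceOf A a x).U} {adj : Z → Prop} {k : Z → ℕ}

theorem Outcome.factor_of_le_one (h : Outcome (pieceOf A a x) F T adj k)
    (hF : ∀ u v : {v // v ≠ a}, F.Adj u v → A'.Adj u v) (hk : ∀ z, k z ≤ 1) {S : Set V}
    (hS : ∀ v, v ∈ S ↔ ∃ hv : v ≠ a, (⟨v, hv⟩ : {v // v ≠ a}) ∈ T ∧ ∀ z, k z = 1 → v ≠ x z) :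
    HasFactor A' S := by
  refine HasFactor.of_subtype_ne (h.hasFactor_of_le_one hk) hF fun v => ?_
  rw [hS]
  refine exists_congr fun hv => and_congr Iff.rfl ?_
  constructor
  · rintro h ⟨z, hz, hz'⟩
    exact h z hz (congrArg Subtype.val hz')
  · rintro h z hz hz'
    exact h ⟨z, hz, Subtype.ext hz'⟩

theorem Outcome.factor_univ_of_two (h : Outcome (pieceOf A a x) F T adj k) (hT : ∀ u, u ∈ T)
    (hF : ∀ u v : {v // v ≠ a}, F.Adj u v → A'.Adj u v) (hadj : ∀ z, k z ≠ 0 → A'.Adj a (x z))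
    {z₀ : Z} (hk : k z₀ = 2) (hk' : ∀ z ≠ z₀, k z = 0) : HasFactor A' Set.univ := by
  obtain ⟨u, -, hu, -, -, hadj', hfac⟩ := h.hasFactor_of_two hk hk'
  change {v // v ≠ a} at u
  have h1 := HasFactor.of_subtype_ne (S := {a, (x z₀ : V), (u : V)}ᶜ) hfac hF (by
    intro v
    have : (∃ hv : v ≠ a, (⟨v, hv⟩ : {v // v ≠ a}) ∈ T \ {x z₀, u}) ↔
        ∃ hv : v ≠ a, (⟨v, hv⟩ : {v // v ≠ a}) ≠ x z₀ ∧ (⟨v, hv⟩ : {v // v ≠ a}) ≠ u := by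
      refine exists_congr fun hv => ?_
      exact ⟨fun h => ⟨fun e => h.2 (.inl e), fun e => h.2 (.inr e)⟩,
        fun h => ⟨hT _, fun e => e.elim h.1 h.2⟩⟩
    refine Iff.trans ?_ this.symm
    simp only [Set.mem_compl_iff, Set.mem_insert_iff, Set.mem_singleton_iff, not_or,
      Subtype.ext_iff, exists_prop, ne_eq])
  have h2 := h1.union_path (L := (a, (x z₀ : V), (u : V)))
    ⟨(x z₀).2.symm, fun h => hu (Subtype.ext h).symm, u.2.symm, hadj _ (by omega), hF _ _ hadj'⟩
    disjoint_compl_right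
  have h3 : pVerts (a, (x z₀ : V), (u : V)) = {a, (x z₀ : V), (u : V)} := rfl
  rwa [h3, Set.union_compl_self] at h2

theorem Outcome.factor_univ_of_one_one (h : Outcome (pieceOf A a x) F T adj k) (hT : ∀ u, u ∈ T)
    (hF : ∀ u v : {v // v ≠ a}, F.Adj u v → A'.Adj u v) (hadj : ∀ z, k z ≠ 0 → A'.Adj a (x z))
    {z₁ z₂ : Z} (hx : x z₁ ≠ x z₂) (hk₁ : k z₁ = 1) (hk₂ : k z₂ = 1)
    (hk : ∀ z, z ≠ z₁ → z ≠ z₂ → k z = 0) : HasFactor A' Set.univ := by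
  have h1 := h.factor_of_le_one (S := {(x z₁ : V), a, (x z₂ : V)}ᶜ) hF (by
    intro z
    by_cases h1 : z = z₁
    · rw [h1, hk₁]
    by_cases h2 : z = z₂
    · rw [h2, hk₂]
    rw [hk z h1 h2]
    exact zero_le_one) (by
    intro v
    constructor
    · intro hv
      simp only [Set.mem_compl_iff, Set.mem_insert_iff, Set.mem_singleton_iff, not_or] at hv
      refine ⟨hv.2.1, hT _, ?_⟩
      rintro z hz rfl
      have h1 : z ≠ z₁ := by
        rintro rfl
        exact hv.1 rfl
      have h2 : z ≠ z₂ := by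
        rintro rfl
        exact hv.2.2 rfl
      rw [hk z h1 h2] at hz
      exact zero_ne_one hz
    · rintro ⟨hv, -, hv'⟩
      simp [hv, hv' _ hk₁, hv' _ hk₂])
  have h2 := h1.union_path (L := ((x z₁ : V), a, (x z₂ : V)))
    ⟨(x z₁).2, (x z₂).2.symm, fun h => hx (Subtype.ext h),
      (hadj _ (by omega)).symm, hadj _ (by omega)⟩
    disjoint_compl_right
  have h3 : pVerts ((x z₁ : V), a, (x z₂ : V)) = {(x z₁ : V), a, (x z₂ : V)} := rfl
  rwa [h3, Set.union_compl_self] at h2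

end PieceOf

theorem ncard_true_three : {z : Fin 3 | (fun _ => True) z}.ncard = 3 := by
  simp [Set.ncard_eq_toFinset_card']

theorem ncard_ne_four (w : Fin 4) : {z : Fin 4 | (fun z => w ≠ z) z}.ncard = 3 := by
  rw [Set.ncard_eq_toFinset_card']
  revert w
  decide

theorem IsCubic.exists_adj {V : Type} [Fintype V] {A : SimpleGraph V} (hA : IsCubic A) (a : V) :
    ∃ b, A.Adj a b :=
  Set.nonempty_of_ncard_ne_zero (s := A.neighborSet a) (by rw [hA]; norm_num)

theorem IsCubic.exists_adj_ne {V : Type} [Fintype V] {A : SimpleGraph V} (hA : IsCubic A)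
    (a b c : V) : ∃ d, A.Adj a d ∧ d ≠ b ∧ d ≠ c := by
  obtain ⟨d, hd, hd'⟩ : ∃ d ∈ A.neighborSet a, d ∉ ({b, c} : Set V) := by
    refine Set.exists_mem_notMem_of_ncard_lt_ncard ?_
    rw [hA]
    exact ((Set.ncard_insert_le _ _).trans (by simp)).trans_lt (by norm_num : 2 < 3)
  simp only [Set.mem_insert_iff, Set.mem_singleton_iff, not_or] at hd'
  exact ⟨d, hd, hd'⟩

/-! ### The implications proved with frames -/

theorem ClaimZ1.claimF1 (h : ClaimZ1) : ClaimF1 := by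
  intro n A hA hk hn a
  obtain ⟨b, hb⟩ := hA.exists_adj a
  obtain ⟨c, hc, hcb, -⟩ := hA.exists_adj_ne a b b
  obtain ⟨x, hx, -, -⟩ := exists_attach hA ncard_true_three hb hc hcb.symm trivial trivial
    (zero_ne_one (α := Fin 3))
  obtain ⟨hC, hK⟩ := frame_three (P := fun _ => pieceOf A a x)
    fun _ => hx.good ncard_true_three hA hk
  have hcard : Nat.card (pieceOf A a x).U = n - 1 := by rw [card_pieceOf, Fintype.card_fin]
  obtain ⟨k, h1, -, h3⟩ := exists_outcome le_rfl (h.hasFactor hC hK (by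
    rw [card_frame_vertices, Fin.sum_univ_three, hcard, Fintype.card_fin]
    omega))
  have hw : ∃ w, ∀ z, k w z = 0 := by
    by_contra! hne
    have key : ∀ w, 3 ≤ ∑ z, k w z := by
      intro w
      obtain ⟨c, hc1, hc2, hc3⟩ := (h3 w).exists_count_univ fun _ => Set.mem_univ _
      obtain ⟨z, hz⟩ := hne w
      have hc0 : c ≠ 0 := fun h => hz (hc2 h z)
      rw [hcard] at hc3
      omega
    have := key 0
    have := key 1
    have := key 2
    have := h1 0
    have := h1 1
    have := h1 2
    simp only [Fin.sum_univ_three] at *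
    omega
  obtain ⟨w, hw⟩ := hw
  have hout : Outcome (pieceOf A a x) _ _ _ _ := h3 w
  refine hout.factor_of_le_one (fun u v h => frame_adj_inr_inr.1 h) (by simp [hw]) ?_
  intro v
  exact ⟨fun hv => ⟨hv, Set.mem_univ _, by simp [hw]⟩, fun ⟨hv, _⟩ => hv⟩

theorem ClaimF1.hasFactor_of_not (h : ClaimF1) {n : ℕ} {A : SimpleGraph (Fin n)}
    (hA : IsCubic A) (hk : KConnected 3 A) (hn : n % 6 = 2) {a b : Fin n} (hab : A.Adj a b)
    (hno : ¬ HasFactor A {a, b}ᶜ) : ClaimZ5 := by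
  rintro m B hB hkB hm ⟨p, a', q⟩ ⟨-, -, hpq, hp, hq⟩
  dsimp only at hpq hp hq
  obtain ⟨c, hc, hcb, -⟩ := hA.exists_adj_ne a b b
  obtain ⟨x, hx, hxb, -⟩ := exists_attach hA (z₁ := (1 : Fin 3)) (z₂ := 2) ncard_true_three hab
    hc hcb.symm trivial trivial (by decide)
  obtain ⟨y, hy, hyb, -⟩ := exists_attach hA (z₁ := (2 : Fin 3)) (z₂ := 1) ncard_true_three hab
    hc hcb.symm trivial trivial (by decide)
  obtain ⟨t, ht, htp, htq⟩ := exists_attach hB (z₁ := (1 : Fin 3)) (z₂ := 2) ncard_true_three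
    hp.symm hq hpq trivial trivial (by decide)
  let P : Fin 3 → Piece (Fin 3) := ![pieceOf A a x, pieceOf A a y, pieceOf B a' t]
  obtain ⟨hC, hK⟩ := frame_three (P := P) (by
    intro w
    fin_cases w
    exacts [hx.good ncard_true_three hA hk, hy.good ncard_true_three hA hk,
      ht.good ncard_true_three hB hkB])
  have c0 : Nat.card (pieceOf A a x).U = n - 1 := by rw [card_pieceOf, Fintype.card_fin]
  have c1 : Nat.card (pieceOf A a y).U = n - 1 := by rw [card_pieceOf, Fintype.card_fin]
  have c2 : Nat.card (pieceOf B a' t).U = m - 1 := by rw [card_pieceOf, Fintype.card_fin]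
  have hm0 := hkB.1
  rw [Fintype.card_fin] at hm0
  obtain ⟨k, h1, h2, h3⟩ := exists_outcome le_rfl (h.hasFactor hC hK (by
    rw [card_frame_vertices, Fin.sum_univ_three, Fintype.card_fin]
    change (3 + (Nat.card (pieceOf A a x).U + Nat.card (pieceOf A a y).U +
      Nat.card (pieceOf B a' t).U)) % 6 = 4
    omega) (.inl 0))
  have o0 : Outcome (pieceOf A a x) _ _ _ _ := h3 0
  have o1 : Outcome (pieceOf A a y) _ _ _ _ := h3 1
  have o2 : Outcome (pieceOf B a' t) _ _ _ _ := h3 2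
  have hmem : ∀ s : Σ w, (P w).U, (.inr s : Fin 3 ⊕ (Σ w, (P w).U)) ∈ ({.inl 0}ᶜ : Set _) := by
    simp
  obtain ⟨d0, e0, -, f0⟩ := o0.exists_count_univ fun _ => hmem _
  obtain ⟨d1, e1, -, f1⟩ := o1.exists_count_univ fun _ => hmem _
  obtain ⟨d2, e2, -, f2⟩ := o2.exists_count_univ fun _ => hmem _
  have z0 := h2 0 (by simp)
  have z00 := z0 0
  have z01 := z0 1
  have z02 := z0 2
  have s1 := h1 1
  have s2 := h1 2
  simp only [Fin.sum_univ_three] at e0 e1 e2 s1 s2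
  have k01 : k 0 1 ≠ 1 := by
    intro hk1
    have k02 : k 0 2 = 0 := by omega
    refine hno (o0.factor_of_le_one (fun u v h => frame_adj_inr_inr.1 h) ?_ ?_)
    · intro z
      fin_cases z <;> simp [*]
    · intro v
      constructor
      · intro hv
        simp only [Set.mem_compl_iff, Set.mem_insert_iff, Set.mem_singleton_iff, not_or] at hv
        refine ⟨hv.1, hmem _, ?_⟩
        intro z
        fin_cases z <;> simp [*]
      · rintro ⟨hv, -, hv'⟩
        have := hv' 1 hk1
        rw [hxb] at this
        simp [hv, this]
  have k12 : k 1 2 ≠ 1 := by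
    intro hk1
    have k11 : k 1 1 = 0 := by omega
    refine hno (o1.factor_of_le_one (fun u v h => frame_adj_inr_inr.1 h) ?_ ?_)
    · intro z
      fin_cases z <;> simp [*]
    · intro v
      constructor
      · intro hv
        simp only [Set.mem_compl_iff, Set.mem_insert_iff, Set.mem_singleton_iff, not_or] at hv
        refine ⟨hv.1, hmem _, ?_⟩
        intro z
        fin_cases z <;> simp [*]
      · rintro ⟨hv, -, hv'⟩
        have := hv' 2 hk1
        rw [hyb] at this
        simp [hv, this]
  have k21 : k 2 1 = 1 := by omega
  have k22 : k 2 2 = 1 := by omega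
  refine o2.factor_of_le_one (fun u v h => frame_adj_inr_inr.1 h) ?_ ?_
  · intro z
    fin_cases z <;> simp [*]
  · intro v
    constructor
    · intro hv
      simp only [pVerts, Set.mem_compl_iff, Set.mem_insert_iff, Set.mem_singleton_iff,
        not_or] at hv
      refine ⟨hv.2.1, hmem _, ?_⟩
      intro z
      fin_cases z <;> simp [*]
    · rintro ⟨hv, -, hv'⟩
      have g1 := hv' 1 k21
      have g2 := hv' 2 k22
      rw [htp] at g1
      rw [htq] at g2
      simp [pVerts, hv, g1, g2]

theorem ClaimZ5.claimT2 (h : ClaimZ5) : ClaimT2 := by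
  intro n A hA hk hn a b hab
  obtain ⟨c, hc, hcb, -⟩ := hA.exists_adj_ne a b b
  obtain ⟨x, hx, hxb, -⟩ := exists_attach hA (z₁ := (2 : Fin 3)) (z₂ := 1) ncard_true_three hab
    hc hcb.symm trivial trivial (by decide)
  let P : Fin 3 → Piece (Fin 3) := ![pointPiece _, pieceOf A a x, pieceOf A a x]
  obtain ⟨hC, hK⟩ := frame_three (P := P) (by
    intro w
    fin_cases w
    exacts [pointPiece_good ncard_true_three, hx.good ncard_true_three hA hk,
      hx.good ncard_true_three hA hk])
  have c0 : Nat.card (pointPiece (Fin 3)).U = 1 := Nat.card_unique (α := Unit)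
  have c1 : Nat.card (pieceOf A a x).U = n - 1 := by rw [card_pieceOf, Fintype.card_fin]
  obtain ⟨k, h1, h2, h3⟩ := exists_outcome le_rfl (h.hasFactor hC hK (by
    rw [card_frame_vertices, Fin.sum_univ_three, Fintype.card_fin]
    change (3 + (Nat.card (pointPiece (Fin 3)).U + Nat.card (pieceOf A a x).U +
      Nat.card (pieceOf A a x).U)) % 6 = 0
    omega) (L := (.inl 0, .inr ⟨0, ()⟩, .inl 1)) ⟨by simp, by simp, by simp,
      frame_adj_inl_inr.2 ⟨trivial, rfl⟩, frame_adj_inr_inl.2 ⟨trivial, rfl⟩⟩)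
  have o1 : Outcome (pieceOf A a x) _ _ _ _ := h3 1
  have o2 : Outcome (pieceOf A a x) _ _ _ _ := h3 2
  have hmem : ∀ w, w ≠ 0 → ∀ u : (P w).U, (.inr ⟨w, u⟩ : Fin 3 ⊕ (Σ w, (P w).U)) ∈
      (pVerts (.inl 0, .inr ⟨0, ()⟩, .inl 1) : Set (Fin 3 ⊕ (Σ w, (P w).U)))ᶜ := by
    rintro w hw u (h | h | h)
    · cases h
    · exact hw (congrArg Sigma.fst (Sum.inr_injective h))
    · cases h
  obtain ⟨d1, e1, -, f1⟩ := o1.exists_count_univ fun _ => hmem 1 (by decide) _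
  obtain ⟨d2, e2, -, f2⟩ := o2.exists_count_univ fun _ => hmem 2 (by decide) _
  have z0 := h2 0 (by simp [pVerts])
  have z1 := h2 1 (by simp [pVerts])
  have z10 := z0 1
  have z20 := z0 2
  have z11 := z1 1
  have z21 := z1 2
  have s2 := h1 2
  simp only [Fin.sum_univ_three] at e1 e2 s2
  have k12 : k 1 2 = 1 := by omega
  refine o1.factor_of_le_one (fun u v h => frame_adj_inr_inr.1 h) ?_ ?_
  · intro z
    fin_cases z <;> simp [*]
  · intro v
    constructor
    · intro hv
      simp only [Set.mem_compl_iff, Set.mem_insert_iff, Set.mem_singleton_iff, not_or] at hv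
      refine ⟨hv.1, hmem 1 (by decide) _, ?_⟩
      intro z
      fin_cases z <;> simp [*]
    · rintro ⟨hv, -, hv'⟩
      have := hv' 2 k12
      rw [hxb] at this
      simp [hv, this]

theorem ClaimF1.claimT2 (h : ClaimF1) : ClaimT2 := by
  intro n A hA hk hn a b hab
  by_contra hno
  exact hno ((h.hasFactor_of_not hA hk hn hab hno).claimT2 n A hA hk hn a b hab)

theorem ClaimT2.claimZ5 (h : ClaimT2) : ClaimZ5 := by
  rintro n A hA hk hn ⟨p, a, q⟩ ⟨-, -, hpq, hp, hq⟩
  dsimp only at hpq hp hq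
  have hp := hp.symm
  by_contra hno
  change ¬ HasFactor A (pVerts (p, a, q))ᶜ at hno
  obtain ⟨x, hx, hxp, hxq⟩ := exists_attach hA (z₁ := (3 : Fin 4)) (z₂ := 2) (ncard_ne_four 0)
    hp hq hpq (by decide) (by decide) (by decide)
  obtain ⟨y, hy, hyp, hyq⟩ := exists_attach hA (z₁ := (0 : Fin 4)) (z₂ := 1) (ncard_ne_four 2)
    hp hq hpq (by decide) (by decide) (by decide)
  obtain ⟨t, ht, htp, htq⟩ := exists_attach hA (z₁ := (1 : Fin 4)) (z₂ := 2) (ncard_ne_four 3)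
    hp hq hpq (by decide) (by decide) (by decide)
  let P : Fin 4 → Piece (Fin 4) :=
    ![pieceOf A a x, pointPiece _, pieceOf A a y, pieceOf A a t]
  obtain ⟨hC, hK⟩ := frame_four (P := P) (by
    intro w
    fin_cases w
    exacts [hx.good (ncard_ne_four 0) hA hk, pointPiece_good (ncard_ne_four 1),
      hy.good (ncard_ne_four 2) hA hk, ht.good (ncard_ne_four 3) hA hk])
  have c0 : Nat.card (pieceOf A a x).U = n - 1 := by rw [card_pieceOf, Fintype.card_fin]
  have c1 : Nat.card (pointPiece (Fin 4)).U = 1 := Nat.card_unique (α := Unit)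
  have c2 : Nat.card (pieceOf A a y).U = n - 1 := by rw [card_pieceOf, Fintype.card_fin]
  have c3 : Nat.card (pieceOf A a t).U = n - 1 := by rw [card_pieceOf, Fintype.card_fin]
  have hn0 := hk.1
  rw [Fintype.card_fin] at hn0
  obtain ⟨k, h1, h2, h3⟩ := exists_outcome le_rfl (h.hasFactor hC hK (by
    rw [card_frame_vertices, Fin.sum_univ_four, Fintype.card_fin]
    change (4 + (Nat.card (pieceOf A a x).U + Nat.card (pointPiece (Fin 4)).U +
      Nat.card (pieceOf A a y).U + Nat.card (pieceOf A a t).U)) % 6 = 2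
    omega) (x := .inl 3) (y := .inr ⟨0, x 3⟩) (frame_adj_inl_inr.2 ⟨by decide, rfl⟩))
  have o0 : Outcome (pieceOf A a x) _ _ _ _ := h3 0
  have o1 : Outcome (pointPiece (Fin 4)) _ _ _ _ := h3 1
  have o2 : Outcome (pieceOf A a y) _ _ _ _ := h3 2
  have o3 : Outcome (pieceOf A a t) _ _ _ _ := h3 3
  have hmem : ∀ w, w ≠ 0 → ∀ u : (P w).U, (.inr ⟨w, u⟩ : Fin 4 ⊕ (Σ w, (P w).U)) ∈
      ({.inl 3, .inr ⟨0, x 3⟩} : Set (Fin 4 ⊕ (Σ w, (P w).U)))ᶜ := by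
    rintro w hw u (h | h)
    · cases h
    · exact hw (congrArg Sigma.fst (Sum.inr_injective h))
  have hmem0 : ∀ u : {v // v ≠ a}, (.inr ⟨0, u⟩ : Fin 4 ⊕ (Σ w, (P w).U)) ∈
      ({.inl 3, .inr ⟨0, x 3⟩} : Set (Fin 4 ⊕ (Σ w, (P w).U)))ᶜ ↔ u ≠ x 3 := by
    intro u
    constructor
    · rintro h rfl
      exact h (.inr rfl)
    · rintro h (h' | h')
      · cases h'
      · exact h (inr_mk_injective 0 (Set.mem_singleton_iff.1 h'))
  obtain ⟨d0, e0, -, f0⟩ := o0.exists_count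
  obtain ⟨d1, e1, -, f1⟩ := o1.exists_count_univ fun _ => hmem 1 (by decide) _
  obtain ⟨d2, e2, -, f2⟩ := o2.exists_count_univ fun _ => hmem 2 (by decide) _
  obtain ⟨d3, e3, -, f3⟩ := o3.exists_count_univ fun _ => hmem 3 (by decide) _
  have hcompl : ∀ u : (pieceOf A a x).U, ({u}ᶜ : Set (pieceOf A a x).U).ncard = n - 1 - 1 := by
    intro u
    rw [Set.ncard_compl, Set.ncard_singleton, c0]
  have f0' : d0 % 3 = (n - 1 - 1) % 3 :=
    f0.trans (congrArg (· % 3) ((congrArg Set.ncard (Set.ext hmem0)).trans (hcompl (x 3))))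
  have hdiag : ∀ w, k w w = 0 := by
    intro w
    by_contra h
    exact (frame_adj_inl_inr.1 ((h3 w).adj_of_ne_zero h)).1 rfl
  have z3 := h2 3 (by simp)
  have g00 := hdiag 0
  have g11 := hdiag 1
  have g22 := hdiag 2
  have g03 := z3 0
  have g13 := z3 1
  have g23 := z3 2
  have g33 := z3 3
  have s0 := h1 0
  have s1 := h1 1
  have s2 := h1 2
  simp only [Fin.sum_univ_four] at e0 e1 e2 e3 s0 s1 s2
  have k02 : k 0 2 ≠ 1 ∨ k 0 1 ≠ 0 := by
    by_contra! hc
    obtain ⟨hc2, hc1⟩ := hc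
    refine hno (o0.factor_of_le_one (fun u v h => frame_adj_inr_inr.1 h) ?_ ?_)
    · intro z
      fin_cases z <;> simp [*]
    · intro v
      constructor
      · intro hv
        simp only [pVerts, Set.mem_compl_iff, Set.mem_insert_iff, Set.mem_singleton_iff,
          not_or] at hv
        refine ⟨hv.2.1, (hmem0 _).2 ?_, ?_⟩
        · intro h
          exact hv.1 ((congrArg Subtype.val h).trans hxp)
        · intro z
          fin_cases z <;> simp [*]
      · rintro ⟨hv, hv1, hv2⟩
        have g1 : v ≠ x 3 := fun h => (hmem0 _).1 hv1 (Subtype.ext h)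
        have g2 := hv2 2 hc2
        rw [hxp] at g1
        rw [hxq] at g2
        simp [pVerts, hv, g1, g2]
  have k2 : k 2 0 ≠ 1 ∨ k 2 1 ≠ 1 := by
    by_contra! hc
    obtain ⟨hc0, hc1⟩ := hc
    refine hno (o2.factor_of_le_one (fun u v h => frame_adj_inr_inr.1 h) ?_ ?_)
    · intro z
      fin_cases z <;> simp [*]
    · intro v
      constructor
      · intro hv
        simp only [pVerts, Set.mem_compl_iff, Set.mem_insert_iff, Set.mem_singleton_iff,
          not_or] at hv
        refine ⟨hv.2.1, hmem 2 (by decide) _, ?_⟩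
        intro z
        fin_cases z <;> simp [*]
      · rintro ⟨hv, -, hv2⟩
        have g1 := hv2 0 hc0
        have g2 := hv2 1 hc1
        rw [hyp] at g1
        rw [hyq] at g2
        simp [pVerts, hv, g1, g2]
  have k3 : k 3 1 ≠ 1 ∨ k 3 2 ≠ 1 ∨ k 3 0 ≠ 0 := by
    by_contra! hc
    obtain ⟨hc1, hc2, hc0⟩ := hc
    refine hno (o3.factor_of_le_one (fun u v h => frame_adj_inr_inr.1 h) ?_ ?_)
    · intro z
      fin_cases z <;> simp [*]
    · intro v
      constructor
      · intro hv
        simp only [pVerts, Set.mem_compl_iff, Set.mem_insert_iff, Set.mem_singleton_iff,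
          not_or] at hv
        refine ⟨hv.2.1, hmem 3 (by decide) _, ?_⟩
        intro z
        fin_cases z <;> simp [*]
      · rintro ⟨hv, -, hv2⟩
        have g1 := hv2 1 hc1
        have g2 := hv2 2 hc2
        rw [htp] at g1
        rw [htq] at g2
        simp [pVerts, hv, g1, g2]
  omega

theorem ClaimF2.claimZ4 (h : ClaimF2) : ClaimZ4 := by
  intro n A hA hk hn X hX hX2
  obtain ⟨e, f, hef, rfl⟩ := Finset.card_eq_two.1 hX2
  have he : e ∈ A.edgeSet := hX (by simp)
  have hf : f ∈ A.edgeSet := hX (by simp)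
  have hsub : ∀ {u v : Fin n}, A.Adj u v → s(u, v) ≠ e → s(u, v) ≠ f →
      (A.deleteEdges (({e, f} : Finset (Sym2 (Fin n))) : Set (Sym2 (Fin n)))).Adj u v := by
    intro u v huv h1 h2
    rw [deleteEdges_adj]
    simp [huv, h1, h2]
  generalize A.deleteEdges (({e, f} : Finset (Sym2 (Fin n))) : Set (Sym2 (Fin n))) = A' at hsub ⊢
  induction e using Sym2.ind with | _ a b
  induction f using Sym2.ind with | _ c d
  rw [mem_edgeSet] at he hf
  let P (x : Fin 3 → {v // v ≠ a}) : Fin 3 → Piece (Fin 3) :=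
    ![pieceOf A a x, pointPiece _, pointPiece _]
  have key : ∀ x : Fin 3 → {v // v ≠ a}, Attach A a (fun _ => True) x →
      ∀ r s : Fin 3 ⊕ (Σ w, (P x w).U), (frame (fun _ _ => True) (P x)).Adj r s →
      .inl 0 ≠ r → .inl 0 ≠ s →
      (∀ u v : {v // v ≠ a}, A.Adj u v →
        s((.inr ⟨0, u⟩ : Fin 3 ⊕ (Σ w, (P x w).U)), .inr ⟨0, v⟩) ≠ s(r, s) → A'.Adj u v) →
      (∀ z, z ≠ 0 → s((.inl z : Fin 3 ⊕ (Σ w, (P x w).U)), .inr ⟨0, x z⟩) ≠ s(r, s) →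
        A'.Adj a (x z)) → HasFactor A' Set.univ := by
    intro x hx r s hrs hr hs hinn hout
    obtain ⟨hC, hK⟩ := frame_three (P := P x) (by
      intro w
      fin_cases w
      exacts [hx.good ncard_true_three hA hk, pointPiece_good ncard_true_three,
        pointPiece_good ncard_true_three])
    have c0 : Nat.card (pieceOf A a x).U = n - 1 := by rw [card_pieceOf, Fintype.card_fin]
    have c1 : Nat.card (pointPiece (Fin 3)).U = 1 := Nat.card_unique (α := Unit)
    have hn0 := hk.1
    rw [Fintype.card_fin] at hn0
    obtain ⟨k, h1, h2, h3⟩ := exists_outcome (deleteEdges_le _) (h.hasFactor hC hK (by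
      rw [card_frame_vertices, Fin.sum_univ_three, Fintype.card_fin]
      change (3 + (Nat.card (pieceOf A a x).U + Nat.card (pointPiece (Fin 3)).U +
        Nat.card (pointPiece (Fin 3)).U)) % 6 = 4
      omega) hrs hr hs)
    have o0 : Outcome (pieceOf A a x) _ _ _ _ := h3 0
    have o1 : Outcome (pointPiece (Fin 3)) _ _ _ _ := h3 1
    have o2 : Outcome (pointPiece (Fin 3)) _ _ _ _ := h3 2
    have hmem : ∀ s : Σ w, (P x w).U,
        (.inr s : Fin 3 ⊕ (Σ w, (P x w).U)) ∈ ({.inl 0}ᶜ : Set _) := by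
      simp
    obtain ⟨d0, e0, -, f0⟩ := o0.exists_count_univ fun _ => hmem _
    obtain ⟨d1, e1, -, f1⟩ := o1.exists_count_univ fun _ => hmem _
    obtain ⟨d2, e2, -, f2⟩ := o2.exists_count_univ fun _ => hmem _
    have z0 := h2 0 (by simp)
    have z00 := z0 0
    have z01 := z0 1
    have z02 := z0 2
    have s1 := h1 1
    have s2 := h1 2
    simp only [Fin.sum_univ_three] at e0 e1 e2 s1 s2
    have hF : ∀ u v : {v // v ≠ a}, (((frame (fun _ _ => True) (P x)).deleteEdges
        {s(r, s)}).comap fun u : (P x 0).U => .inr ⟨0, u⟩).Adj u v → A'.Adj u v := by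
      intro u v huv
      have huv' := (deleteEdges_adj.1 huv : _)
      exact hinn u v (frame_adj_inr_inr.1 huv'.1) huv'.2
    have hadj : ∀ z, k 0 z ≠ 0 → A'.Adj a (x z) := by
      intro z hz
      have hz' := o0.adj_of_ne_zero hz
      refine hout z ?_ (deleteEdges_adj.1 hz').2
      rintro rfl
      exact hz z00
    have h012 : ∀ z : Fin 3, z = 0 ∨ z = 1 ∨ z = 2 := by decide
    obtain ⟨g1, g2⟩ | ⟨g1, g2⟩ | ⟨g1, g2⟩ : (k 0 1 = 2 ∧ k 0 2 = 0) ∨ (k 0 1 = 1 ∧ k 0 2 = 1) ∨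
        (k 0 2 = 2 ∧ k 0 1 = 0) := by omega
    · refine o0.factor_univ_of_two (fun _ => hmem _) hF hadj g1 fun z hz => ?_
      obtain rfl | rfl | rfl := h012 z
      exacts [z00, absurd rfl hz, g2]
    · refine o0.factor_univ_of_one_one (fun _ => hmem _) hF hadj ?_ g1 g2 fun z hz hz' => ?_
      · intro he
        exact absurd (hx.inj _ _ trivial trivial he) (by decide)
      obtain rfl | rfl | rfl := h012 z
      exacts [z00, absurd rfl hz, absurd rfl hz']
    · refine o0.factor_univ_of_two (fun _ => hmem _) hF hadj g1 fun z hz => ?_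
      obtain rfl | rfl | rfl := h012 z
      exacts [z00, g2, absurd rfl hz]
  change HasFactor A' Set.univ
  have hadj0 : ∀ {u v : {v // v ≠ a}}, s((u : Fin n), (v : Fin n)) ≠ s(a, b) := by
    intro u v h
    have : a ∈ s((u : Fin n), (v : Fin n)) := h ▸ Sym2.mem_mk_left a b
    rcases Sym2.mem_iff.1 this with h | h
    exacts [u.2 h.symm, v.2 h.symm]
  have star : ∀ c, A.Adj a c → b ≠ c → (∀ {u v : Fin n}, A.Adj u v → s(u, v) ≠ s(a, b) →
      s(u, v) ≠ s(a, c) → A'.Adj u v) → HasFactor A' Set.univ := by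
    intro c hc hbc hsub
    obtain ⟨x, hx, hxb, hxc⟩ := exists_attach hA (z₁ := (0 : Fin 3)) (z₂ := 1) ncard_true_three he
      hc hbc trivial trivial (by decide)
    refine key x hx (.inl 1) (.inr ⟨0, x 1⟩) (frame_adj_inl_inr.2 ⟨trivial, rfl⟩) (by simp)
      (by simp) ?_ ?_
    · rintro u v huv -
      refine hsub huv hadj0 fun h => ?_
      have : a ∈ s((u : Fin n), (v : Fin n)) := h ▸ Sym2.mem_mk_left a c
      rcases Sym2.mem_iff.1 this with h | h
      exacts [u.2 h.symm, v.2 h.symm]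
    · intro z hz hz'
      refine hsub (hx.adj z trivial) ?_ ?_
      · intro h
        rw [← hxb, Sym2.congr_right] at h
        exact hz (hx.inj _ _ trivial trivial (Subtype.ext h))
      · intro h
        rw [← hxc, Sym2.congr_right] at h
        have := hx.inj _ _ trivial trivial (Subtype.ext h)
        subst this
        exact hz' rfl
  by_cases hac : a = c
  · subst hac
    exact star d hf (fun h => hef (by rw [h])) hsub
  by_cases had : a = d
  · subst had
    exact star c hf.symm (fun h => hef (by rw [h, Sym2.eq_swap]))
      fun h1 h2 h3 => hsub h1 h2 (by rwa [Sym2.eq_swap (a := c)])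
  obtain ⟨t, ht, htb, -⟩ := hA.exists_adj_ne a b b
  obtain ⟨x, hx, hxb, -⟩ := exists_attach hA (z₁ := (0 : Fin 3)) (z₂ := 1) ncard_true_three he
    ht htb.symm trivial trivial (by decide)
  refine key x hx (.inr ⟨0, (⟨c, Ne.symm hac⟩ : {v // v ≠ a})⟩)
    (.inr ⟨0, (⟨d, Ne.symm had⟩ : {v // v ≠ a})⟩) (frame_adj_inr_inr.2 hf) (by simp)
    (by simp) ?_ ?_
  · intro u v huv huv'
    refine hsub huv hadj0 fun h => huv' ?_
    rcases Sym2.eq_iff.1 h with ⟨h1, h2⟩ | ⟨h1, h2⟩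
    · obtain rfl : u = ⟨c, Ne.symm hac⟩ := Subtype.ext h1
      obtain rfl : v = ⟨d, Ne.symm had⟩ := Subtype.ext h2
      rfl
    · obtain rfl : u = ⟨d, Ne.symm had⟩ := Subtype.ext h1
      obtain rfl : v = ⟨c, Ne.symm hac⟩ := Subtype.ext h2
      exact Sym2.eq_swap
  · rintro z hz -
    refine hsub (hx.adj z trivial) ?_ ?_
    · intro h
      rw [← hxb, Sym2.congr_right] at h
      exact hz (hx.inj _ _ trivial trivial (Subtype.ext h))
    · intro h
      have : a ∈ s(c, d) := h ▸ Sym2.mem_mk_left a _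
      rcases Sym2.mem_iff.1 this with h | h
      exacts [hac h, had h]

/-! ### Claims about graphs with a multiple of six vertices -/

theorem ClaimZ4.claimZ2 (h : ClaimZ4) : ClaimZ2 := by
  intro n A hA hk hn e he
  induction e using Sym2.ind with | _ a b
  rw [mem_edgeSet] at he
  obtain ⟨c, hc, hcb, -⟩ := hA.exists_adj_ne a b b
  have hne : s(a, b) ≠ s(a, c) := fun h => hcb (Sym2.congr_right.1 h).symm
  obtain ⟨Q, hQ⟩ := h n A hA hk hn {s(a, b), s(a, c)} (by
    intro f hf
    simp only [Finset.coe_insert, Finset.coe_singleton, Set.mem_insert_iff,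
      Set.mem_singleton_iff] at hf
    rcases hf with rfl | rfl
    exacts [he, hc]) (Finset.card_pair hne)
  refine ⟨Q, hQ.mono (deleteEdges_le _), ?_⟩
  rintro ⟨p, hp, hpe⟩
  obtain ⟨-, -, -, h1, h2⟩ := hQ.1.1 p hp
  rcases hpe with h' | h'
  · exact (deleteEdges_adj.1 h1).2 (by rw [← h']; simp)
  · exact (deleteEdges_adj.1 h2).2 (by rw [← Set.mem_singleton_iff.1 h']; simp)

theorem exists_mem_edgeSet {n : ℕ} {A : SimpleGraph (Fin n)} (hA : IsCubic A)
    (hk : KConnected 3 A) : ∃ e, e ∈ A.edgeSet := by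
  have hn := hk.1
  rw [Fintype.card_fin] at hn
  obtain ⟨b, hb⟩ := hA.exists_adj (⟨0, by omega⟩ : Fin n)
  exact ⟨s(_, b), hb⟩

theorem ClaimZ2.claimZ1 (h : ClaimZ2) : ClaimZ1 := by
  intro n A hA hk hn
  obtain ⟨e, he⟩ := exists_mem_edgeSet hA hk
  obtain ⟨Q, hQ, -⟩ := h n A hA hk hn e he
  exact ⟨Q, hQ⟩

theorem ClaimZ3.claimZ1 (h : ClaimZ3) : ClaimZ1 := by
  intro n A hA hk hn
  obtain ⟨e, he⟩ := exists_mem_edgeSet hA hk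
  obtain ⟨Q, hQ, -⟩ := h n A hA hk hn e he
  exact ⟨Q, hQ⟩

theorem ClaimZ5.claimZ3 (h : ClaimZ5) : ClaimZ3 := by
  intro n A hA hk hn e he
  induction e using Sym2.ind with | _ a b
  rw [mem_edgeSet] at he
  obtain ⟨c, hc, hca, -⟩ := hA.exists_adj_ne b a a
  have hL : IsPathL A (a, b, c) := ⟨he.ne, hc.ne, hca.symm, he, hc⟩
  obtain ⟨Q, hQ⟩ := h n A hA hk hn _ hL
  have hQ' := hQ.insert hL disjoint_compl_right
  rw [Set.union_compl_self] at hQ'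
  exact ⟨_, hQ', _, Finset.mem_insert_self _ _, .inl rfl⟩

/-! ### Joining two subdivided edges -/

section Bridge

variable {V : Type} {A : SimpleGraph V} {E : Bool → Sym2 V}

/-- Adjacency in `bridge A E`. -/
def BridgeAdj (A : SimpleGraph V) (E : Bool → Sym2 V) : V ⊕ Bool → V ⊕ Bool → Prop
  | .inl u, .inl v => A.Adj u v ∧ ∀ i, s(u, v) ≠ E i
  | .inl u, .inr i => u ∈ E i
  | .inr i, .inl u => u ∈ E i
  | .inr i, .inr j => i ≠ j

/-- The graph obtained from `A` by subdividing the edges `E true` and `E false` and joining the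
two new vertices. -/
def bridge (A : SimpleGraph V) (E : Bool → Sym2 V) : SimpleGraph (V ⊕ Bool) where
  Adj := BridgeAdj A E
  symm := by
    constructor
    rintro (u | i) (v | j) h
    · exact ⟨h.1.symm, fun i => Sym2.eq_swap ▸ h.2 i⟩
    · exact h
    · exact h
    · exact Ne.symm h
  loopless := by
    constructor
    rintro (u | i) h
    · exact A.irrefl h.1
    · exact h rfl

theorem bridge_isCubic (hA : IsCubic A) (hE : ∀ i, E i ∈ A.edgeSet)
    (hdisj : ∀ v, v ∈ E true → v ∉ E false) : IsCubic (bridge A E) := by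
  classical
  rintro (u | i)
  · let φ : V → V ⊕ Bool := fun v =>
      if s(u, v) = E true then .inr true else if s(u, v) = E false then .inr false else .inl v
    have hφ : (bridge A E).neighborSet (.inl u) = φ '' A.neighborSet u := by
      ext w
      constructor
      · intro hw
        rcases w with v | i
        · have hw' : A.Adj u v ∧ ∀ i, s(u, v) ≠ E i := hw
          exact ⟨v, hw'.1, by simp [φ, hw'.2]⟩
        · have hw' : u ∈ E i := hw
          obtain ⟨v, hv⟩ := hw'
          have hadj : A.Adj u v := by
            have := hE i
            rwa [hv, mem_edgeSet] at this
          refine ⟨v, hadj, ?_⟩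
          cases i
          · have : s(u, v) ≠ E true := fun h =>
              hdisj u (h ▸ Sym2.mem_mk_left u v) (hv ▸ Sym2.mem_mk_left u v)
            exact (if_neg this).trans (if_pos hv.symm)
          · exact if_pos hv.symm
      · rintro ⟨v, hv, rfl⟩
        simp only [φ]
        split_ifs with h1 h2
        · exact (h1 ▸ Sym2.mem_mk_left u v : u ∈ E true)
        · exact (h2 ▸ Sym2.mem_mk_left u v : u ∈ E false)
        · refine ⟨hv, ?_⟩
          rintro (_ | _)
          exacts [h2, h1]
    rw [hφ, Set.InjOn.ncard_image, hA u]
    intro v _ v' _ h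
    simp only [φ] at h
    split_ifs at h with h1 h2
    · exact Sym2.congr_right.1 (h1.trans h2.symm)
    · cases h
    · cases h
    · exact Sym2.congr_right.1 (Eq.trans ‹_› (Eq.symm ‹s(u, v') = E false›))
    · exact Sum.inl_injective h
  · obtain ⟨⟨a, b⟩, hab⟩ := (E i).exists_rep
    have hadj : A.Adj a b := by
      have := hE i
      rwa [← hab] at this
    have : (bridge A E).neighborSet (.inr i) = {.inl a, .inl b, .inr !i} := by
      ext w
      rcases w with v | j
      · have : (bridge A E).Adj (.inr i) (.inl v) ↔ v ∈ E i := Iff.rfl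
        rw [mem_neighborSet, this, ← hab]
        change v ∈ s(a, b) ↔ _
        simp
      · have : (bridge A E).Adj (.inr i) (.inr j) ↔ i ≠ j := Iff.rfl
        rw [mem_neighborSet, this]
        cases i <;> cases j <;> simp
    rw [this]
    exact Set.ncard_eq_three.2 ⟨_, _, _, by simpa using hadj.ne, by simp, by simp, rfl⟩

theorem linked_bridge_of_adj {D : Set (V ⊕ Bool)} {u v : V} (h : A.Adj u v) (hu : .inl u ∉ D)
    (hv : .inl v ∉ D) (hi : ∀ i, s(u, v) = E i → .inr i ∉ D) :
    Linked (bridge A E) D (.inl u) (.inl v) := by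
  by_cases hE : ∃ i, s(u, v) = E i
  · obtain ⟨i, hE⟩ := hE
    have h1 : (bridge A E).Adj (.inl u) (.inr i) := (hE ▸ Sym2.mem_mk_left u v : u ∈ E i)
    have h2 : (bridge A E).Adj (.inr i) (.inl v) := (hE ▸ Sym2.mem_mk_right u v : v ∈ E i)
    exact (Linked.of_adj h1 hu (hi i hE)).trans (.of_adj h2 (hi i hE) hv)
  · exact .of_adj ⟨h, fun i hi => hE ⟨i, hi⟩⟩ hu hv

theorem bridge_kConnected [Fintype V] (hA : IsCubic A) (hk : KConnected 3 A)
    (hE : ∀ i, E i ∈ A.edgeSet) (hdisj : ∀ v i, v ∈ E i → v ∉ E !i) :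
    KConnected 3 (bridge A E) := by
  have hlen : ∀ i, ∃ c d, c ≠ d ∧ E i = s(c, d) := by
    intro i
    obtain ⟨⟨c, d⟩, h⟩ := (E i).exists_rep
    have := hE i
    rw [← h] at this
    exact ⟨c, d, Adj.ne this, h.symm⟩
  have mixed : ∀ d i u v, u ≠ d → v ≠ d →
      Linked (bridge A E) {.inl d, .inr i} (.inl u) (.inl v) := by
    intro d i u v hu hv
    have hin : ∀ {w : V}, w ≠ d → (.inl w : V ⊕ Bool) ∉ ({.inl d, .inr i} : Set (V ⊕ Bool)) := by
      intro w hw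
      simp [hw]
    have hir : ∀ {j : Bool}, j ≠ i →
        (.inr j : V ⊕ Bool) ∉ ({.inl d, .inr i} : Set (V ⊕ Bool)) := by
      intro w hw
      simp [hw]
    refine (hk.linked_pair (p := d) (q := d) hu hu hv hv).lift Sum.inl fun u v huv hu hv => ?_
    simp only [Set.mem_insert_iff, Set.mem_singleton_iff, or_self] at hu hv
    by_cases hi : s(u, v) = E i
    · obtain ⟨c, hc, hcv, hcd⟩ := hA.exists_adj_ne u v d
      have h1 : Linked (bridge A E) {.inl d, .inr i} (.inl u) (.inl c) := by
        refine linked_bridge_of_adj hc (hin hu) (hin hcd) fun j hj => hir ?_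
        rintro rfl
        exact hcv (Sym2.congr_right.1 (hj.trans hi.symm))
      refine h1.trans ?_
      refine (hk.linked_pair (p := u) (q := d) hc.ne' hcd huv.ne' hv).lift Sum.inl
        fun x y hxy hx hy => ?_
      simp only [Set.mem_insert_iff, Set.mem_singleton_iff, not_or] at hx hy
      refine linked_bridge_of_adj hxy (hin hx.2) (hin hy.2) fun j hj => hir ?_
      rintro rfl
      have : u ∈ s(x, y) := by
        rw [hj, ← hi]
        exact Sym2.mem_mk_left u v
      rcases Sym2.mem_iff.1 this with h | h
      exacts [hx.1 h.symm, hy.1 h.symm]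
    · refine linked_bridge_of_adj huv (hin hu) (hin hv) fun j hj => hir ?_
      rintro rfl
      exact hi hj
  have both : ∀ u v, Linked (bridge A E) (Set.range .inr) (.inl u) (.inl v) := by
    intro u v
    have hin : ∀ {w : V}, (.inl w : V ⊕ Bool) ∉ Set.range (.inr : Bool → V ⊕ Bool) := by
      simp
    refine (hk.linked (D := ∅) (by simp) (Set.notMem_empty u) (Set.notMem_empty v)).lift Sum.inl
      fun u v huv _ _ => ?_
    by_cases hi : ∃ i, s(u, v) = E i
    · obtain ⟨i, hi⟩ := hi
      have hui : u ∈ E i := hi ▸ Sym2.mem_mk_left u v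
      have hvi : v ∈ E i := hi ▸ Sym2.mem_mk_right u v
      obtain ⟨c, hc, hcv, -⟩ := hA.exists_adj_ne u v v
      have h1 : Linked (bridge A E) (Set.range .inr) (.inl u) (.inl c) := by
        refine linked_bridge_of_adj hc hin hin fun j hj => ?_
        exfalso
        obtain rfl | rfl : j = i ∨ j = !i := by cases i <;> cases j <;> simp
        · exact hcv (Sym2.congr_right.1 (hj.trans hi.symm))
        · exact hdisj u i hui (hj ▸ Sym2.mem_mk_left u c)
      refine h1.trans ?_
      obtain ⟨d, hd, hdc⟩ : ∃ d, d ∈ E (!i) ∧ c ≠ d := by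
        obtain ⟨x, y, hxy, hE'⟩ := hlen !i
        rw [hE']
        by_cases h : c = x
        · exact ⟨y, by simp, h ▸ hxy⟩
        · exact ⟨x, by simp, h⟩
      have hvd : v ≠ d := by
        rintro rfl
        exact hdisj v i hvi hd
      refine (hk.linked_pair (p := u) (q := d) hc.ne' hdc huv.ne' hvd).lift Sum.inl
        fun x y hxy hx hy => ?_
      simp only [Set.mem_insert_iff, Set.mem_singleton_iff, not_or] at hx hy
      refine linked_bridge_of_adj hxy hin hin fun j hj => ?_
      exfalso
      obtain rfl | rfl : j = i ∨ j = !i := by cases i <;> cases j <;> simp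
      · rw [← hj] at hui
        rcases Sym2.mem_iff.1 hui with h | h
        exacts [hx.1 h.symm, hy.1 h.symm]
      · rw [← hj] at hd
        rcases Sym2.mem_iff.1 hd with h | h
        exacts [hx.2 h.symm, hy.2 h.symm]
    · exact linked_bridge_of_adj huv hin hin fun j hj => absurd ⟨j, hj⟩ hi
  refine kConnected_three_of_pair ?_ fun p q => ?_
  · have := hk.1
    rw [Fintype.card_sum]
    omega
  have inner : ∀ u v : V, .inl u ≠ p → .inl u ≠ q → .inl v ≠ p → .inl v ≠ q →
      Linked (bridge A E) {p, q} (.inl u) (.inl v) := by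
    intro u v hup huq hvp hvq
    rcases p with c | i <;> rcases q with d | j
    · refine (hk.linked_pair (p := c) (q := d) (by simpa using hup) (by simpa using huq)
        (by simpa using hvp) (by simpa using hvq)).lift Sum.inl fun x y hxy hx hy => ?_
      simp only [Set.mem_insert_iff, Set.mem_singleton_iff, not_or] at hx hy
      exact linked_bridge_of_adj hxy (by simp [hx]) (by simp [hy]) fun j _ => by simp
    · exact mixed _ _ _ _ (by simpa using hup) (by simpa using hvp)
    · rw [Set.pair_comm]
      exact mixed _ _ _ _ (by simpa using huq) (by simpa using hvq)
    · refine (both u v).mono ?_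
      rintro _ (rfl | rfl)
      exacts [⟨_, rfl⟩, ⟨_, rfl⟩]
  have exit : ∀ i, .inr i ≠ p → .inr i ≠ q → ∃ v : V, .inl v ≠ p ∧ .inl v ≠ q ∧
      Linked (bridge A E) {p, q} (.inr i) (.inl v) := by
    intro i hip hiq
    have hi : (.inr i : V ⊕ Bool) ∉ ({p, q} : Set _) := by simp [hip, hiq]
    by_cases hv : ∃ v ∈ E i, .inl v ≠ p ∧ .inl v ≠ q
    · obtain ⟨v, hv, h1, h2⟩ := hv
      have hadj : (bridge A E).Adj (.inr i) (.inl v) := hv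
      exact ⟨v, h1, h2, .of_adj hadj hi (by simp [h1, h2])⟩
    obtain ⟨c, d, hcd, hEi⟩ := hlen i
    have hfull : ∀ w, w ∈ ({p, q} : Set (V ⊕ Bool)) → ∃ v ∈ E i, w = .inl v := by
      push Not at hv
      have hc := hv c (by simp [hEi])
      have hd := hv d (by simp [hEi])
      have hcd' : (.inl c : V ⊕ Bool) ≠ .inl d := fun h => hcd (Sum.inl_injective h)
      rintro w (rfl | rfl)
      · by_cases h : .inl c = w
        · exact ⟨c, by simp [hEi], h.symm⟩
        · refine ⟨d, by simp [hEi], ?_⟩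
          by_contra h'
          exact hcd' ((hc h).trans (hd (Ne.symm h')).symm)
      · by_cases h : .inl c = w
        · exact ⟨c, by simp [hEi], h.symm⟩
        · refine ⟨d, by simp [hEi], ?_⟩
          by_contra h'
          have h1 : .inl c = p := by
            by_contra h1
            exact h (hc h1)
          have h2 : .inl d = p := by
            by_contra h2
            exact h' (hd h2).symm
          exact hcd' (h1.trans h2.symm)
    have hni : (.inr !i : V ⊕ Bool) ∉ ({p, q} : Set (V ⊕ Bool)) := by
      intro h
      obtain ⟨v, -, hv⟩ := hfull _ h
      cases hv
    obtain ⟨x, y, -, hE'⟩ := hlen !i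
    have hx : x ∈ E !i := by simp [hE']
    have hxn : (.inl x : V ⊕ Bool) ∉ ({p, q} : Set (V ⊕ Bool)) := by
      intro h
      obtain ⟨v, hv, h⟩ := hfull _ h
      rw [Sum.inl_injective h] at hx
      exact hdisj v i hv hx
    have h1 : (bridge A E).Adj (.inr i) (.inr !i) := by
      change i ≠ !i
      simp
    have h2 : (bridge A E).Adj (.inr !i) (.inl x) := hx
    refine ⟨x, fun h => hxn (.inl h), fun h => hxn (.inr h), ?_⟩
    exact (Linked.of_adj h1 hi hni).trans (.of_adj h2 hni hxn)
  have exit' : ∀ w, w ≠ p → w ≠ q → ∃ v : V, .inl v ≠ p ∧ .inl v ≠ q ∧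
      Linked (bridge A E) {p, q} w (.inl v) := by
    rintro (v | i) h1 h2
    · exact ⟨v, h1, h2, .refl⟩
    · exact exit i h1 h2
  intro u v hup huq hvp hvq
  obtain ⟨u', h1, h2, h3⟩ := exit' u hup huq
  obtain ⟨v', h4, h5, h6⟩ := exit' v hvp hvq
  exact (h3.trans (inner _ _ h1 h2 h4 h5)).trans h6.symm

end Bridge

theorem ClaimZ5.claimF2 (h : ClaimZ5) : ClaimF2 := by
  intro n A hA hk hn a e he hae
  induction e using Sym2.ind with | _ p q
  rw [mem_edgeSet] at he
  obtain ⟨b, hb, hbp, hbq⟩ := hA.exists_adj_ne a p q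
  simp only [Sym2.mem_iff, not_or] at hae
  let E : Bool → Sym2 (Fin n) := fun i => if i then s(a, b) else s(p, q)
  have hE : ∀ i, E i ∈ A.edgeSet := by
    rintro (_ | _)
    exacts [he, hb]
  have hdisj : ∀ v i, v ∈ E i → v ∉ E !i := by
    rintro v (_ | _) h1 h2
    · have h1' : v = p ∨ v = q := by simpa [E] using h1
      have h2' : v = a ∨ v = b := by simpa [E] using h2
      grind
    · have h1' : v = a ∨ v = b := by simpa [E] using h1
      have h2' : v = p ∨ v = q := by simpa [E] using h2
      grind
  have hL : IsPathL (bridge A E) (.inl a, .inr true, .inr false) := by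
    refine ⟨by simp, by simp, by simp, ?_, ?_⟩
    · exact Sym2.mem_mk_left a b
    · change true ≠ false
      decide
  have hfac := h.hasFactor (bridge_isCubic hA hE fun v => hdisj v true)
    (bridge_kConnected hA hk hE hdisj) (by
      rw [Fintype.card_sum, Fintype.card_fin, Fintype.card_bool]
      omega) hL
  have himg : (pVerts (.inl a, .inr true, .inr false) : Set (Fin n ⊕ Bool))ᶜ =
      .inl '' ({a}ᶜ : Set (Fin n)) := by
    ext w
    rcases w with v | (_ | _) <;> simp [pVerts]
  rw [himg] at hfac
  refine hfac.of_image Sum.inl_injective fun u v huv => ?_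
  have huv' : A.Adj u v ∧ ∀ i, s(u, v) ≠ E i := huv
  exact deleteEdges_adj.2 ⟨huv'.1, huv'.2 false⟩

/-- The eight claims (z1)–(z5), (t2), (f1), (f2) are pairwise equivalent. -/
theorem stmt4 :
    [ClaimZ1, ClaimZ2, ClaimZ3, ClaimZ4, ClaimZ5, ClaimT2, ClaimF1, ClaimF2].TFAE := by
  tfae_have 1 → 7 := ClaimZ1.claimF1
  tfae_have 7 → 6 := ClaimF1.claimT2
  tfae_have 6 → 5 := ClaimT2.claimZ5
  tfae_have 5 → 8 := ClaimZ5.claimF2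
  tfae_have 8 → 4 := ClaimF2.claimZ4
  tfae_have 4 → 2 := ClaimZ4.claimZ2
  tfae_have 2 → 1 := ClaimZ2.claimZ1
  tfae_have 5 → 3 := ClaimZ5.claimZ3
  tfae_have 3 → 1 := ClaimZ3.claimZ1
  tfae_finish
end

section
/- For every natural number N there exists a graph G such that G is 2-connected, cubic, and bipartite, v(G) ≡ 0 (mod 6), v(G) > N, and G has no Λ-factor (in particular λ(G) < ⌊v(G)/3⌋). -/
open SimpleGraph

open Finset in
/-- Deleting a vertex from a connected cubic bipartite graph leaves a connected graph: a union of
components of the remainder contains either none or all of the neighbours of that vertex,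
by counting edges modulo 3. -/
lemma IsCubic.connected_induce_compl_singleton {V : Type*} [Fintype V] {G : SimpleGraph V}
    (hconn : G.Connected) (hcub : IsCubic G) (hcol : G.Colorable 2) (v : V) :
    (G.induce ({v}ᶜ : Set V)).Connected := by
  classical
  obtain ⟨c⟩ := hcol
  have hdeg : ∀ x, #{y | G.Adj x y} = 3 := fun x => by
    rw [← hcub x, ← Set.ncard_coe_finset]
    congr 1
    ext y
    simp
  have key : ∀ w : ({v}ᶜ : Set V), ∀ x (hx : G.Adj v x),
      (G.induce ({v}ᶜ : Set V)).Reachable w ⟨x, hx.ne'⟩ := by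
    intro w
    set C : Finset V := univ.filter fun x =>
      ∃ h : x ∈ ({v}ᶜ : Set V), (G.induce ({v}ᶜ : Set V)).Reachable w ⟨x, h⟩ with hC
    have hvC : v ∉ C := by simp [hC]
    have hwC : w.1 ∈ C := by
      simp only [hC, mem_filter, mem_univ, true_and]
      exact ⟨w.2, Reachable.refl _⟩
    have hstep : ∀ x ∈ C, ∀ y, G.Adj x y → y ≠ v → y ∈ C := by
      intro x hx y hxy hy
      simp only [hC, mem_filter, mem_univ, true_and] at hx ⊢
      obtain ⟨h, hr⟩ := hx
      refine ⟨hy, hr.trans (Adj.reachable ?_)⟩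
      simpa using hxy
    set A : Finset V := C.filter fun x => c x = c v with hA
    set B : Finset V := C.filter fun x => c x ≠ c v with hB
    have hvA : v ∉ A := fun h => hvC (mem_filter.1 h).1
    have hcount := sum_card_bipartiteAbove_eq_sum_card_bipartiteBelow (s := insert v A) (t := B)
      G.Adj
    have hright : ∀ y ∈ B, #(bipartiteBelow G.Adj (insert v A) y) = 3 := by
      intro y hy
      rw [← hdeg y]
      congr 1
      ext x
      simp only [mem_bipartiteBelow, mem_insert, mem_filter, mem_univ, true_and]
      refine ⟨fun h => h.2.symm, fun h => ⟨?_, h.symm⟩⟩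
      by_cases hxv : x = v
      · exact Or.inl hxv
      · obtain ⟨hyC, hyc⟩ := mem_filter.1 hy
        have h1 := c.valid h
        exact Or.inr (mem_filter.2 ⟨hstep y hyC x h hxv, by omega⟩)
    have hleft : ∀ x ∈ A, #(bipartiteAbove G.Adj B x) = 3 := by
      intro x hx
      rw [← hdeg x]
      congr 1
      ext y
      simp only [mem_bipartiteAbove, mem_filter, mem_univ, true_and]
      refine ⟨fun h => h.2, fun h => ⟨?_, h⟩⟩
      obtain ⟨hxC, hxc⟩ := mem_filter.1 hx
      have h1 := c.valid h
      have h2 : c y ≠ c v := fun h3 => h1 (hxc.trans h3.symm)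
      exact mem_filter.2 ⟨hstep x hxC y h fun h3 => h2 (h3 ▸ rfl), h2⟩
    rw [sum_insert hvA, sum_congr rfl hleft, sum_congr rfl hright, sum_const, sum_const,
      smul_eq_mul, smul_eq_mul] at hcount
    have hsub : bipartiteAbove G.Adj B v ⊆ ({y | G.Adj v y} : Finset V) := fun y hy => by
      simpa using ((mem_bipartiteAbove _).1 hy).2
    have hle := card_le_card hsub
    rw [hdeg v] at hle
    have hcases : #(bipartiteAbove G.Adj B v) = 0 ∨ #(bipartiteAbove G.Adj B v) = 3 := by omega
    rcases hcases with h0 | h3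
    · exfalso
      have hno : ∀ x ∈ C, ¬ G.Adj v x := by
        intro x hx hvx
        have hmem : x ∈ bipartiteAbove G.Adj B v :=
          (mem_bipartiteAbove _).2 ⟨mem_filter.2 ⟨hx, (c.valid hvx).symm⟩, hvx⟩
        rw [card_eq_zero.1 h0] at hmem
        simp at hmem
      have hall : ∀ x y, G.Walk x y → x ∈ C → y ∈ C := by
        intro x y p
        induction p with
        | nil => exact id
        | cons h _ ih =>
          intro hx
          exact ih (hstep _ hx _ h fun h' => hno _ hx (h' ▸ h.symm))
      obtain ⟨p⟩ := hconn.preconnected w.1 v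
      exact hvC (hall _ _ p hwC)
    · intro x hx
      have heq := eq_of_subset_of_card_le hsub (by rw [hdeg v, h3])
      have hmem : x ∈ bipartiteAbove G.Adj B v := by rw [heq]; simpa using hx
      have hxC : x ∈ C := (mem_filter.1 ((mem_bipartiteAbove _).1 hmem).1).1
      simp only [hC, mem_filter, mem_univ, true_and] at hxC
      exact hxC.2
  obtain ⟨x, hx⟩ : ∃ x, G.Adj v x := by
    have h : ({y | G.Adj v y} : Finset V).Nonempty := by
      rw [← card_pos, hdeg v]
      norm_num
    obtain ⟨x, hx⟩ := h
    exact ⟨x, by simpa using hx⟩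
  exact
    { preconnected := fun w w' => (key w x hx).trans (key w' x hx).symm
      nonempty := ⟨⟨x, hx.ne'⟩⟩ }

lemma IsCubic.kConnected_two {V : Type*} [Fintype V] {G : SimpleGraph V}
    (hconn : G.Connected) (hcub : IsCubic G) (hcol : G.Colorable 2) : KConnected 2 G := by
  classical
  refine ⟨?_, fun S hS => ?_⟩
  · obtain ⟨v⟩ := hconn.nonempty
    rw [← Nat.card_eq_fintype_card, ← Set.ncard_univ]
    have h := Set.ncard_le_ncard (Set.subset_univ (G.neighborSet v)) (Set.toFinite _)
    rw [hcub v] at h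
    exact h
  · obtain h0 | h1 : S.ncard = 0 ∨ S.ncard = 1 := by omega
    · rw [(Set.ncard_eq_zero (Set.toFinite S)).1 h0, Set.compl_empty]
      exact (induceUnivIso G).connected_iff.2 hconn
    · obtain ⟨v, rfl⟩ := Set.ncard_eq_one.1 h1
      exact IsCubic.connected_induce_compl_singleton hconn hcub hcol v

section Packing

open Finset

variable {V : Type*} [DecidableEq V]

/-- The vertices of an encoded 3-vertex path, as a finset. -/
def pFinset (p : V × V × V) : Finset V := {p.1, p.2.1, p.2.2}

lemma coe_pFinset (p : V × V × V) : (pFinset p : Set V) = pVerts p := by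
  simp [pFinset, pVerts]

lemma IsPathL.card_pFinset {G : SimpleGraph V} {p : V × V × V} (h : IsPathL G p) :
    #(pFinset p) = 3 :=
  card_eq_three.2 ⟨_, _, _, h.1, h.2.2.1, h.2.1, rfl⟩

lemma IsPacking.pairwiseDisjoint {G : SimpleGraph V} {P : Finset (V × V × V)}
    (h : IsPacking G P) : (P : Set (V × V × V)).PairwiseDisjoint pFinset := by
  intro p hp q hq hpq
  rw [Function.onFun, ← disjoint_coe, coe_pFinset, coe_pFinset]
  exact h.2 p hp q hq hpq

lemma IsPacking.card_biUnion {G : SimpleGraph V} {P : Finset (V × V × V)}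
    (h : IsPacking G P) : #(P.biUnion pFinset) = 3 * #P := by
  rw [Finset.card_biUnion h.pairwiseDisjoint, sum_congr rfl fun p hp => (h.1 p hp).card_pFinset,
    sum_const, smul_eq_mul, mul_comm]

lemma IsFactor.sum_card_inter {G : SimpleGraph V} {P : Finset (V × V × V)} (h : IsFactor G P)
    (C : Finset V) : ∑ p ∈ P, #(pFinset p ∩ C) = #C := by
  rw [← Finset.card_biUnion]
  · congr 1
    ext v
    simp only [mem_biUnion, mem_inter]
    refine ⟨fun ⟨_, _, _, hv⟩ => hv, fun hv => ?_⟩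
    obtain ⟨p, hp, hvp⟩ := h.2.2 v trivial
    rw [← coe_pFinset] at hvp
    exact ⟨p, hp, hvp, hv⟩
  · intro p hp q hq hpq
    exact (h.1.pairwiseDisjoint hp hq hpq).mono inter_subset_left inter_subset_left

/-- A 3-vertex path avoiding `S` lies inside or outside a set `C` whose outer boundary is
contained in `S`. -/
lemma IsPathL.three_dvd_card_inter {G : SimpleGraph V} {p : V × V × V} (h : IsPathL G p)
    {S C : Finset V} (hC : ∀ u ∈ C, ∀ v, G.Adj u v → v ∈ C ∨ v ∈ S) (hp : pFinset p ∩ S = ∅) :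
    3 ∣ #(pFinset p ∩ C) := by
  have hS : ∀ v ∈ pFinset p, v ∉ S := fun v hv hvS => by
    have : v ∈ pFinset p ∩ S := mem_inter.2 ⟨hv, hvS⟩
    simp [hp] at this
  have h1 := hS p.1 (by simp [pFinset])
  have h2 := hS p.2.1 (by simp [pFinset])
  have h3 := hS p.2.2 (by simp [pFinset])
  by_cases hm : p.2.1 ∈ C
  · have hsub : pFinset p ⊆ C := by
      intro v hv
      simp only [pFinset, mem_insert, mem_singleton] at hv
      rcases hv with rfl | rfl | rfl
      · exact (hC _ hm _ h.2.2.2.1.symm).resolve_right h1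
      · exact hm
      · exact (hC _ hm _ h.2.2.2.2).resolve_right h3
    rw [inter_eq_left.2 hsub, h.card_pFinset]
  · have hemp : pFinset p ∩ C = ∅ := by
      refine eq_empty_of_forall_notMem fun v hv => ?_
      obtain ⟨hv, hvC⟩ := mem_inter.1 hv
      simp only [pFinset, mem_insert, mem_singleton] at hv
      rcases hv with rfl | rfl | rfl
      · exact hm ((hC _ hvC _ h.2.2.2.1).resolve_right h2)
      · exact hm hvC
      · exact hm ((hC _ hvC _ h.2.2.2.2.symm).resolve_right h2)
    simp [hemp]

/-- If deleting `S` cuts off more than `#S` disjoint pieces of order `2` modulo `3`,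
there is no `Λ`-factor. -/
lemma not_isFactor_of_card_lt {ι : Type*} [Fintype ι] {G : SimpleGraph V}
    (S : Finset V) (C : ι → Finset V)
    (hdisj : Pairwise fun i j => Disjoint (C i) (C j)) (hCS : ∀ i, Disjoint (C i) S)
    (hC : ∀ i, ∀ u ∈ C i, ∀ v, G.Adj u v → v ∈ C i ∨ v ∈ S)
    (hmod : ∀ i, #(C i) % 3 = 2) (hcard : #S < Fintype.card ι) (P : Finset (V × V × V)) :
    ¬ IsFactor G P := by
  intro hP
  set Q := P.filter fun p => (pFinset p ∩ S).Nonempty with hQ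
  have hpiece : ∀ i, 2 ≤ ∑ p ∈ Q, #(pFinset p ∩ C i) := by
    intro i
    have hsum := hP.sum_card_inter (C i)
    rw [← sum_filter_add_sum_filter_not P fun p => (pFinset p ∩ S).Nonempty,
      ← hQ] at hsum
    have hdvd : 3 ∣ ∑ p ∈ P with ¬ (pFinset p ∩ S).Nonempty, #(pFinset p ∩ C i) :=
      dvd_sum fun p hp => by
        obtain ⟨hp, hpS⟩ := mem_filter.1 hp
        exact (hP.1.1 p hp).three_dvd_card_inter (hC i)
          (not_nonempty_iff_eq_empty.1 hpS)
    have := hmod i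
    omega
  have hpath : ∀ p ∈ Q, ∑ i, #(pFinset p ∩ C i) ≤ 2 * #(pFinset p ∩ S) := by
    intro p hp
    obtain ⟨hpP, hpS⟩ := mem_filter.1 hp
    have hpos := card_pos.2 hpS
    have hle : ∑ i, #(pFinset p ∩ C i) + #(pFinset p ∩ S) ≤ 3 := by
      rw [← (hP.1.1 p hpP).card_pFinset, ← Finset.card_biUnion, ← card_union_of_disjoint]
      · refine card_le_card (union_subset (biUnion_subset.2 fun i _ => ?_) ?_) <;>
          exact inter_subset_left
      · refine (disjoint_biUnion_left _ _ _).2 fun i _ => ?_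
        exact (hCS i).mono inter_subset_right inter_subset_right
      · intro i _ j _ hij
        exact (hdisj hij).mono inter_subset_right inter_subset_right
    omega
  have h1 : 2 * Fintype.card ι ≤ ∑ i, ∑ p ∈ Q, #(pFinset p ∩ C i) := by
    have := sum_le_sum fun i (_ : i ∈ (univ : Finset ι)) => hpiece i
    rw [sum_const, smul_eq_mul, card_univ] at this
    omega
  have h2 : ∑ p ∈ Q, 2 * #(pFinset p ∩ S) ≤ 2 * #S := by
    rw [← hP.sum_card_inter S, ← mul_sum]
    exact Nat.mul_le_mul_left _ (sum_le_sum_of_subset (filter_subset _ _))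
  rw [sum_comm] at h1
  have := sum_le_sum hpath
  omega

end Packing

lemma lambdaNum_lt_of_not_isFactor {V : Type*} [Fintype V] {G : SimpleGraph V}
    (hdvd : 3 ∣ Fintype.card V) (hG : ¬ ∃ P, IsFactor G P) :
    lambdaNum G < Fintype.card V / 3 := by
  classical
  have hlt : ∀ n ∈ {n | ∃ P : Finset (V × V × V), IsPacking G P ∧ P.card = n},
      n < Fintype.card V / 3 := by
    rintro n ⟨P, hP, rfl⟩
    have hcard := hP.card_biUnion
    have hle := Finset.card_le_univ (P.biUnion pFinset)
    by_contra hge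
    refine hG ⟨P, hP, fun _ _ => Set.subset_univ _, fun v _ => ?_⟩
    have huniv : P.biUnion pFinset = Finset.univ :=
      Finset.eq_univ_of_card _ (by omega)
    have hv := Finset.mem_univ v
    rw [← huniv, Finset.mem_biUnion] at hv
    obtain ⟨p, hp, hvp⟩ := hv
    exact ⟨p, hp, by rw [← coe_pFinset]; exact hvp⟩
  refine hlt _ (Nat.sSup_mem ⟨0, ∅, ?_, rfl⟩ ⟨Fintype.card V / 3, fun n hn => (hlt n hn).le⟩)
  simp [IsPacking]

/-- The vertices of `K₃,₃` together with, for each of its edges, those of a circular ladder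
or Möbius ladder on `2 * m` vertices. -/
abbrev LadderVertex (m : ℕ) : Type :=
  (Fin 3 ⊕ Fin 3) ⊕ (Fin 3 × Fin 3) × ZMod m × Bool

/-- The three neighbours of a vertex in the graph obtained from `K₃,₃` by inserting into each
edge a ladder on `ZMod m × Bool` (with `(s, true)` adjacent to `(s, false)` and
`(s ± 1, false)`) opened at its edge from `(-1, true)` to `(0, false)`. -/
def ladderNeighbor {m : ℕ} : LadderVertex m → Fin 3 → LadderVertex m
  | .inl (.inl i), k => .inr ((i, k), 0, false)
  | .inl (.inr j), k => .inr ((k, j), -1, true)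
  | .inr (e, s, b), 0 => .inr (e, s, !b)
  | .inr (e, s, false), 1 => if s = 0 then .inl (.inl e.1) else .inr (e, s - 1, true)
  | .inr (e, s, true), 1 => if s + 1 = 0 then .inl (.inr e.2) else .inr (e, s + 1, false)
  | .inr (e, s, false), 2 => .inr (e, s + 1, true)
  | .inr (e, s, true), 2 => .inr (e, s - 1, false)

/-- The side of a vertex in the bipartition. -/
def ladderSide {m : ℕ} : LadderVertex m → Bool
  | .inl (.inl _) => true
  | .inl (.inr _) => false
  | .inr (_, _, b) => b

lemma ladderSide_ladderNeighbor {m : ℕ} (v : LadderVertex m) (k : Fin 3) :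
    ladderSide (ladderNeighbor v k) = !ladderSide v := by
  rcases v with (i | j) | ⟨e, s, b⟩
  · rfl
  · rfl
  · fin_cases k <;> cases b <;> simp [ladderNeighbor] <;> (try split_ifs) <;> rfl

lemma exists_ladderNeighbor_eq {m : ℕ} (v : LadderVertex m) (k : Fin 3) :
    ∃ k', ladderNeighbor (ladderNeighbor v k) k' = v := by
  rcases v with (i | j) | ⟨⟨i, j⟩, s, b⟩
  · exact ⟨1, by simp [ladderNeighbor]⟩
  · exact ⟨1, by simp [ladderNeighbor]⟩
  · fin_cases k
    · exact ⟨0, by simp [ladderNeighbor]⟩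
    · cases b
      · by_cases h : s = 0
        · exact ⟨j, by simp [ladderNeighbor, h]⟩
        · exact ⟨1, by simp [ladderNeighbor, h]⟩
      · by_cases h : s + 1 = 0
        · exact ⟨i, by simp [ladderNeighbor, eq_neg_of_add_eq_zero_left h]⟩
        · exact ⟨1, by simp [ladderNeighbor, h]⟩
    · exact ⟨2, by cases b <;> simp [ladderNeighbor]⟩

/-- `K₃,₃` with an opened ladder on `2 * m` vertices inserted into each edge. -/
def ladderGraph (m : ℕ) : SimpleGraph (LadderVertex m) where
  Adj u v := ∃ k, ladderNeighbor u k = v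
  symm := ⟨by
    rintro u _ ⟨k, rfl⟩
    exact exists_ladderNeighbor_eq u k⟩
  loopless := ⟨by
    rintro u ⟨k, hk⟩
    have := ladderSide_ladderNeighbor u k
    simp [hk] at this⟩

lemma ladderGraph_adj_ladderNeighbor {m : ℕ} (v : LadderVertex m) (k : Fin 3) :
    (ladderGraph m).Adj v (ladderNeighbor v k) := ⟨k, rfl⟩

lemma ladderGraph_colorable (m : ℕ) : (ladderGraph m).Colorable 2 := by
  refine (Coloring.mk (α := Bool) ladderSide ?_).colorable
  rintro u _ ⟨k, rfl⟩
  simp [ladderSide_ladderNeighbor]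

lemma ladderNeighbor_injective {m : ℕ} (hm : 3 ≤ m) (v : LadderVertex m) :
    Function.Injective (ladderNeighbor v) := by
  have : Fact (1 < m) := ⟨by omega⟩
  have h2 : (2 : ZMod m) ≠ 0 := by
    intro h
    have := (ZMod.natCast_eq_zero_iff 2 m).1 (by exact_mod_cast h)
    have := Nat.le_of_dvd two_pos this
    omega
  have hpm : ∀ s : ZMod m, s + 1 ≠ s - 1 := fun s h => h2 (by linear_combination h)
  have h01 : ∀ s : ZMod m, s - 1 ≠ s := fun s h => one_ne_zero (α := ZMod m)
    (by linear_combination -h)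
  rcases v with (i | j) | ⟨⟨i, j⟩, s, b⟩
  · intro k k' h
    simpa [ladderNeighbor] using h
  · intro k k' h
    simpa [ladderNeighbor] using h
  · intro k k'
    fin_cases k <;> fin_cases k' <;> cases b <;> simp [ladderNeighbor] <;> (try split_ifs) <;>
      simp [hpm, (hpm _).symm, h01, (h01 _).symm]

lemma ladderGraph_isCubic {m : ℕ} (hm : 3 ≤ m) : IsCubic (ladderGraph m) := by
  intro v
  have h : (ladderGraph m).neighborSet v = ladderNeighbor v '' Set.univ := by
    ext w
    simp [ladderGraph]
  rw [h, Set.ncard_image_of_injective _ (ladderNeighbor_injective hm v), Set.ncard_univ]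
  simp

lemma ladderGraph_connected (m : ℕ) [NeZero m] : (ladderGraph m).Connected := by
  have step : ∀ (v : LadderVertex m) (k : Fin 3),
      (ladderGraph m).Reachable v (ladderNeighbor v k) :=
    fun v k => (ladderGraph_adj_ladderNeighbor v k).reachable
  have hnat : ∀ (e : Fin 3 × Fin 3) (n : ℕ),
      (ladderGraph m).Reachable (.inr (e, (n : ZMod m), false)) (.inr (e, 0, false)) := by
    intro e n
    induction n with
    | zero => simp
    | succ n ih =>
      have h1 := step (.inr (e, ((n + 1 : ℕ) : ZMod m), false)) 0
      have h2 := step (.inr (e, ((n + 1 : ℕ) : ZMod m), true)) 2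
      simp only [ladderNeighbor, Nat.cast_add, Nat.cast_one, add_sub_cancel_right] at h1 h2
      simpa using (h1.trans h2).trans ih
  have hfalse : ∀ (e : Fin 3 × Fin 3) (s : ZMod m),
      (ladderGraph m).Reachable (.inr (e, s, false)) (.inl (.inl e.1)) := by
    intro e s
    have h := step (.inr (e, 0, false)) 1
    simp only [ladderNeighbor, if_true] at h
    have := (hnat e s.val).trans h
    rwa [ZMod.natCast_zmod_val] at this
  have htrue : ∀ (e : Fin 3 × Fin 3) (s : ZMod m),
      (ladderGraph m).Reachable (.inr (e, s, true)) (.inl (.inl e.1)) :=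
    fun e s => (step (.inr (e, s, true)) 0).trans (hfalse e s)
  have hright : ∀ i j : Fin 3,
      (ladderGraph m).Reachable (.inl (.inr j)) (.inl (.inl i)) :=
    fun i j => (step (.inl (.inr j)) i).trans (htrue (i, j) (-1))
  have hroot : ∀ v, (ladderGraph m).Reachable v (.inl (.inr 0)) := by
    rintro ((i | j) | ⟨e, s, _ | _⟩)
    · exact (hright i 0).symm
    · exact (hright 0 j).trans (hright 0 0).symm
    · exact (hfalse e s).trans (hright e.1 0).symm
    · exact (htrue e s).trans (hright e.1 0).symm
  exact
    { preconnected := fun u v => (hroot u).trans (hroot v).symm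
      nonempty := ⟨.inl (.inl 0)⟩ }

lemma ladderGraph_not_isFactor {m : ℕ} [NeZero m] (hm : m % 3 = 1)
    (P : Finset (LadderVertex m × LadderVertex m × LadderVertex m)) :
    ¬ IsFactor (ladderGraph m) P := by
  classical
  refine not_isFactor_of_card_lt (ι := Fin 3 × Fin 3)
    (Finset.univ.map Function.Embedding.inl)
    (fun e => Finset.univ.map ((Function.Embedding.sectR e (ZMod m × Bool)).trans .inr)) ?_ ?_ ?_ ?_ ?_ P
  · intro e e' he
    rw [Finset.disjoint_left]
    intro v hv hv'
    simp only [Finset.mem_map, Finset.mem_univ, true_and, Function.Embedding.trans_apply,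
      Function.Embedding.sectR_apply, Function.Embedding.inr_apply] at hv hv'
    obtain ⟨x, rfl⟩ := hv
    obtain ⟨y, hy⟩ := hv'
    simp only [Sum.inr.injEq, Prod.mk.injEq] at hy
    exact he hy.1.symm
  · intro e
    rw [Finset.disjoint_left]
    intro v hv hv'
    simp only [Finset.mem_map, Finset.mem_univ, true_and, Function.Embedding.trans_apply,
      Function.Embedding.sectR_apply, Function.Embedding.inr_apply] at hv hv'
    obtain ⟨x, rfl⟩ := hv
    obtain ⟨y, hy⟩ := hv'
    simp at hy
  · rintro e u hu _ ⟨k, rfl⟩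
    simp only [Finset.mem_map, Finset.mem_univ, true_and, Function.Embedding.trans_apply,
      Function.Embedding.sectR_apply, Function.Embedding.inr_apply] at hu ⊢
    obtain ⟨⟨s, b⟩, rfl⟩ := hu
    fin_cases k <;> cases b <;> simp [ladderNeighbor] <;> split_ifs <;> simp
  · intro e
    simp only [Finset.card_map, Finset.card_univ, Fintype.card_prod, ZMod.card, Fintype.card_bool]
    omega
  · simp

lemma Fintype.card_ladderVertex (m : ℕ) [NeZero m] :
    Fintype.card (LadderVertex m) = 6 + 18 * m := by
  simp only [Fintype.card_sum, Fintype.card_prod, Fintype.card_fin, ZMod.card, Fintype.card_bool]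
  ring

lemma IsCubic.of_iso {V W : Type*} {G : SimpleGraph V} {H : SimpleGraph W} (f : G ≃g H)
    (h : IsCubic H) : IsCubic G := by
  intro v
  have himg : f '' G.neighborSet v = H.neighborSet (f v) := by
    ext w
    obtain ⟨w, rfl⟩ := f.surjective w
    simp [f.map_adj_iff]
  rw [← h (f v), ← himg, Set.ncard_image_of_injective _ f.injective]

/-- Isomorphisms carry `Λ`-factors to `Λ`-factors. -/
lemma IsFactor.exists_of_iso {V W : Type*} {G : SimpleGraph V} {H : SimpleGraph W} (f : G ≃g H)
    {P : Finset (V × V × V)} (hP : IsFactor G P) : ∃ Q, IsFactor H Q := by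
  have hverts : ∀ p : V × V × V, pVerts (f p.1, f p.2.1, f p.2.2) = f '' pVerts p := fun p => by
    simp [pVerts, Set.image_insert_eq]
  refine ⟨P.map (f.toEquiv.prodCongr (f.toEquiv.prodCongr f.toEquiv)).toEmbedding,
    ⟨?_, ?_⟩, fun _ _ => Set.subset_univ _, ?_⟩
  · intro q hq
    obtain ⟨p, hp, rfl⟩ := Finset.mem_map.1 hq
    obtain ⟨h1, h2, h3, h4, h5⟩ := hP.1.1 p hp
    exact ⟨f.injective.ne h1, f.injective.ne h2, f.injective.ne h3,
      f.map_adj_iff.2 h4, f.map_adj_iff.2 h5⟩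
  · intro q hq q' hq' hne
    obtain ⟨p, hp, rfl⟩ := Finset.mem_map.1 hq
    obtain ⟨p', hp', rfl⟩ := Finset.mem_map.1 hq'
    have hd := hP.1.2 p hp p' hp' fun h => hne (h ▸ rfl)
    have := (Set.disjoint_image_iff f.injective).2 hd
    rwa [← hverts, ← hverts] at this
  · intro w _
    obtain ⟨v, rfl⟩ := f.surjective w
    obtain ⟨p, hp, hv⟩ := hP.2.2 v trivial
    refine ⟨_, Finset.mem_map_of_mem _ hp, ?_⟩
    have := Set.mem_image_of_mem f hv
    rwa [← hverts] at this

/-- There are arbitrarily large 2-connected, cubic, bipartite graphs `G` with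
`v(G) ≡ 0 (mod 6)` and no `Λ`-factor (in particular `λ(G) < ⌊v(G)/3⌋`). -/
theorem stmt13 (N : ℕ) :
    ∃ (n : ℕ) (G : SimpleGraph (Fin n)),
      KConnected 2 G ∧ IsCubic G ∧ G.Colorable 2 ∧ n % 6 = 0 ∧ N < n ∧
      (¬ ∃ P, IsFactor G P) ∧ lambdaNum G < n / 3 := by
  obtain ⟨m, hm, hm3, hmN⟩ : ∃ m, m % 3 = 1 ∧ 3 ≤ m ∧ N ≤ m := ⟨3 * N + 4, by omega, by omega,
    by omega⟩
  have : NeZero m := ⟨by omega⟩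
  let e : Fin (6 + 18 * m) ≃ LadderVertex m :=
    (Fintype.equivFinOfCardEq (Fintype.card_ladderVertex m)).symm
  let G : SimpleGraph (Fin (6 + 18 * m)) := (ladderGraph m).comap e
  let f : G ≃g ladderGraph m := Iso.comap e (ladderGraph m)
  have hconn : G.Connected := f.connected_iff.2 (ladderGraph_connected m)
  have hcub : IsCubic G := (ladderGraph_isCubic hm3).of_iso f
  have hcol : G.Colorable 2 := (ladderGraph_colorable m).of_hom f.toHom
  have hno : ¬ ∃ P, IsFactor G P := by
    rintro ⟨P, hP⟩
    obtain ⟨Q, hQ⟩ := hP.exists_of_iso f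
    exact ladderGraph_not_isFactor hm Q hQ
  refine ⟨6 + 18 * m, G, hcub.kConnected_two hconn hcol, hcub, hcol, by omega, by omega, hno, ?_⟩
  simpa using lambdaNum_lt_of_not_isFactor (by rw [Fintype.card_fin]; omega) hno
end

section
/- Let A and B be disjoint cubic graphs with v(A) ≡ 0 (mod 6) and v(B) ≡ 0 (mod 6), let a be a vertex of A with neighbors a₁,a₂,a₃ and b a vertex of B with neighbors b₁,b₂,b₃, and let H = AaσbB. Suppose that A has no Λ-factor containing the edge aa₁. Then v(H) ≡ 4 (mod 6) and every Λ-factor of H − b₂ contains the edge a₃b₃ (i.e., H − b₂ has no Λ-factor avoiding a₃b₃). -/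
open SimpleGraph

/-- The graph `AaσbB`: delete vertices `a` from `A` and `b` from `B`, then join the
neighbors `a₁,a₂,a₃` of `a` to the neighbors `b₁,b₂,b₃` of `b` by the matching
`a₁b₁, a₂b₂, a₃b₃`. -/
def glueV {VA VB : Type*} (A : SimpleGraph VA) (B : SimpleGraph VB) (a : VA) (b : VB)
    (a1 a2 a3 : VA) (b1 b2 b3 : VB) :
    SimpleGraph ({x : VA // x ≠ a} ⊕ {y : VB // y ≠ b}) :=
  SimpleGraph.fromRel fun u v =>
    match u, v with
    | Sum.inl x, Sum.inl y => A.Adj x.1 y.1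
    | Sum.inl x, Sum.inr y =>
        (x.1 = a1 ∧ y.1 = b1) ∨ (x.1 = a2 ∧ y.1 = b2) ∨ (x.1 = a3 ∧ y.1 = b3)
    | Sum.inr x, Sum.inr y => B.Adj x.1 y.1
    | Sum.inr _, Sum.inl _ => False

/-- The vertices of an encoded path of `AaσbB` lying on the side of `A`. -/
def leftVerts {α β : Type*} [DecidableEq α] [DecidableEq β]
    (p : (α ⊕ β) × (α ⊕ β) × (α ⊕ β)) : Finset (α ⊕ β) :=
  ({p.1, p.2.1, p.2.2} : Finset (α ⊕ β)).filter (fun v => v.isLeft = true)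

/-- The map `AaσbB → A` contracting the side of `B` to the vertex `a`. -/
def contractSide {VA VB : Type*} (a : VA) (b : VB) :
    {x : VA // x ≠ a} ⊕ {y : VB // y ≠ b} → VA :=
  Sum.elim Subtype.val (fun _ => a)

/-- The image of an encoded path under a map of vertices. -/
def mapPath {V W : Type*} (f : V → W) (p : V × V × V) : W × W × W :=
  (f p.1, f p.2.1, f p.2.2)

theorem mem_pVerts_mapPath {V W : Type*} {f : V → W} {p : V × V × V} {w : W} :
    w ∈ pVerts (mapPath f p) ↔ ∃ v ∈ pVerts p, f v = w := by
  simp [pVerts, mapPath, eq_comm]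

section Glue

variable {VA VB : Type*} {A : SimpleGraph VA} {B : SimpleGraph VB} {a : VA} {b : VB}
  {a1 a2 a3 : VA} {b1 b2 b3 : VB}

theorem glueV_adj_inl_inl {x y : {x : VA // x ≠ a}} :
    (glueV A B a b a1 a2 a3 b1 b2 b3).Adj (Sum.inl x) (Sum.inl y) ↔ A.Adj x.1 y.1 := by
  simp only [glueV, SimpleGraph.fromRel_adj, A.adj_comm y.1 x.1, or_self, and_iff_right_iff_imp]
  intro h e
  cases e
  exact A.irrefl h

theorem glueV_adj_inl_inr {x : {x : VA // x ≠ a}} {y : {y : VB // y ≠ b}} :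
    (glueV A B a b a1 a2 a3 b1 b2 b3).Adj (Sum.inl x) (Sum.inr y) ↔
      (x.1 = a1 ∧ y.1 = b1) ∨ (x.1 = a2 ∧ y.1 = b2) ∨ (x.1 = a3 ∧ y.1 = b3) := by
  simp [glueV, SimpleGraph.fromRel_adj]

/-- The ways a path of `AaσbB` all of whose crossing edges start at `a₁` can meet the side of `A`. -/
theorem path_cases [DecidableEq VA] [DecidableEq VB] (ha1 : a1 ≠ a) (haa1 : A.Adj a a1)
    {p : ({x : VA // x ≠ a} ⊕ {y : VB // y ≠ b}) × ({x : VA // x ≠ a} ⊕ {y : VB // y ≠ b}) ×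
      ({x : VA // x ≠ a} ⊕ {y : VB // y ≠ b})}
    (hp : IsPathL (glueV A B a b a1 a2 a3 b1 b2 b3) p)
    (hcross : ∀ x y, s(Sum.inl x, Sum.inr y) ∈ pEdges p → x = ⟨a1, ha1⟩ ∧ y.1 = b1) :
    leftVerts p = ∅ ∨
    ((leftVerts p).card = 3 ∧ IsPathL A (mapPath (contractSide a b) p) ∧
      a ∉ pVerts (mapPath (contractSide a b) p)) ∨
    ((leftVerts p).card = 1 ∧ Sum.inl ⟨a1, ha1⟩ ∈ pVerts p) ∨
    ((leftVerts p).card = 2 ∧ Sum.inl ⟨a1, ha1⟩ ∈ pVerts p ∧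
      IsPathL A (mapPath (contractSide a b) p) ∧
      a ∈ pVerts (mapPath (contractSide a b) p) ∧
      s(a, a1) ∈ pEdges (mapPath (contractSide a b) p)) := by
  obtain ⟨u, v, w⟩ := p
  obtain ⟨h1, h2, h3, h4, h5⟩ := hp
  simp only at h1 h2 h3 h4 h5
  rcases u with x | x <;> rcases v with y | y <;> rcases w with z | z
  · right; left
    rw [glueV_adj_inl_inl] at h4 h5
    have h1' : x.1 ≠ y.1 := h4.ne
    have h2' : y.1 ≠ z.1 := h5.ne
    have h3' : x.1 ≠ z.1 := fun h => h3 (congrArg Sum.inl (Subtype.ext h))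
    refine ⟨?_, ⟨h1', h2', h3', h4, h5⟩, ?_⟩
    · rw [leftVerts, Finset.filter_true_of_mem (by simp), Finset.card_eq_three]
      exact ⟨_, _, _, h1, h3, h2, rfl⟩
    · simp [pVerts, mapPath, contractSide, x.2.symm, y.2.symm, z.2.symm]
  · right; right; right
    rw [glueV_adj_inl_inl] at h4
    obtain ⟨rfl, -⟩ := hcross y z (by simp [pEdges])
    refine ⟨?_, by simp [pVerts], ⟨h4.ne, ha1, x.2, h4, haa1.symm⟩, ?_, ?_⟩
    · simp [leftVerts, Finset.filter_insert, Finset.filter_singleton, Finset.card_pair h1]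
    · simp [pVerts, mapPath, contractSide]
    · simp [pEdges, mapPath, contractSide]
  · exfalso
    obtain ⟨rfl, -⟩ := hcross x y (by simp [pEdges])
    obtain ⟨rfl, -⟩ := hcross z y (by simp [pEdges])
    exact h3 rfl
  · right; right; left
    obtain ⟨rfl, -⟩ := hcross x y (by simp [pEdges])
    refine ⟨?_, by simp [pVerts]⟩
    simp [leftVerts, Finset.filter_insert, Finset.filter_singleton]
  · right; right; right
    rw [glueV_adj_inl_inl] at h5
    obtain ⟨rfl, -⟩ := hcross y x (by simp [pEdges])
    refine ⟨?_, by simp [pVerts], ⟨ha1.symm, h5.ne, z.2.symm, haa1, h5⟩, ?_, ?_⟩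
    · simp [leftVerts, Finset.filter_insert, Finset.filter_singleton, Finset.card_pair h2]
    · simp [pVerts, mapPath, contractSide]
    · simp [pEdges, mapPath, contractSide]
  · exfalso
    obtain ⟨-, hx⟩ := hcross y x (by simp [pEdges])
    obtain ⟨-, hz⟩ := hcross y z (by simp [pEdges])
    exact h3 (congrArg Sum.inr (Subtype.ext (hx.trans hz.symm)))
  · right; right; left
    obtain ⟨rfl, -⟩ := hcross z y (by simp [pEdges])
    refine ⟨?_, by simp [pVerts]⟩
    simp [leftVerts, Finset.filter_insert, Finset.filter_singleton]
  · left
    simp [leftVerts, Finset.filter_insert, Finset.filter_singleton]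

end Glue

theorem mem_leftVerts {α β : Type*} [DecidableEq α] [DecidableEq β]
    {p : (α ⊕ β) × (α ⊕ β) × (α ⊕ β)} {v : α ⊕ β} :
    v ∈ leftVerts p ↔ v ∈ pVerts p ∧ v.isLeft = true := by
  simp [leftVerts, pVerts]

/-- Disjoint paths covering the left side partition it. -/
theorem sum_card_leftVerts {α β : Type*} [Fintype α] [DecidableEq α] [DecidableEq β]
    {P : Finset ((α ⊕ β) × (α ⊕ β) × (α ⊕ β))}
    (hdisj : ∀ p ∈ P, ∀ q ∈ P, p ≠ q → Disjoint (pVerts p) (pVerts q))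
    (hcover : ∀ x : α, ∃ p ∈ P, Sum.inl x ∈ pVerts p) :
    ∑ p ∈ P, (leftVerts p).card = Fintype.card α := by
  rw [← Finset.card_biUnion]
  · have h : P.biUnion leftVerts = Finset.univ.map (Function.Embedding.inl (α := α) (β := β)) := by
      ext v
      rcases v with x | y
      · simpa only [Finset.mem_biUnion, mem_leftVerts, Sum.isLeft_inl, and_true, Finset.mem_map,
          Finset.mem_univ, true_and, Function.Embedding.inl_apply, Sum.inl.injEq, exists_eq, iff_true]
          using hcover x
      · simp only [Finset.mem_biUnion, mem_leftVerts, Sum.isLeft_inr, Finset.mem_map,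
          Function.Embedding.inl_apply, reduceCtorEq, and_false, exists_false, iff_self]
    rw [h, Finset.card_map, Finset.card_univ]
  · intro p hp q hq hpq
    rw [Function.onFun, Finset.disjoint_left]
    intro v hv hv'
    exact Set.disjoint_left.mp (hdisj p hp q hq hpq) (mem_leftVerts.mp hv).1 (mem_leftVerts.mp hv').1

/-- If `A, B` are cubic with `v(A) ≡ v(B) ≡ 0 (mod 6)` and `A` has no `Λ`-factor
containing `aa₁`, then `H = AaσbB` satisfies `v(H) ≡ 4 (mod 6)` and every `Λ`-factor
of `H − b₂` contains the edge `a₃b₃`. -/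
theorem stmt14 {VA VB : Type*} [Fintype VA] [Fintype VB] [DecidableEq VA] [DecidableEq VB]
    (A : SimpleGraph VA) (B : SimpleGraph VB) (a : VA) (b : VB)
    (a1 a2 a3 : VA) (b1 b2 b3 : VB)
    (hcA : IsCubic A) (hcB : IsCubic B)
    (hmA : Fintype.card VA % 6 = 0) (hmB : Fintype.card VB % 6 = 0)
    (hNa : A.neighborSet a = {a1, a2, a3})
    (ha12 : a1 ≠ a2) (ha13 : a1 ≠ a3) (ha23 : a2 ≠ a3)
    (hNb : B.neighborSet b = {b1, b2, b3})
    (hb12 : b1 ≠ b2) (hb13 : b1 ≠ b3) (hb23 : b2 ≠ b3)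
    (ha1 : a1 ≠ a) (ha2 : a2 ≠ a) (ha3 : a3 ≠ a)
    (hb1 : b1 ≠ b) (hb2 : b2 ≠ b) (hb3 : b3 ≠ b)
    (hA : ¬ ∃ P, IsFactor A P ∧ PContains P s(a, a1)) :
    Fintype.card ({x : VA // x ≠ a} ⊕ {y : VB // y ≠ b}) % 6 = 4 ∧
    ∀ P, IsFactorOn (glueV A B a b a1 a2 a3 b1 b2 b3)
        ({(Sum.inr ⟨b2, hb2⟩ : {x : VA // x ≠ a} ⊕ {y : VB // y ≠ b})}ᶜ : Set _) P →
      PContains P s((Sum.inl ⟨a3, ha3⟩ : {x : VA // x ≠ a} ⊕ {y : VB // y ≠ b}),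
        (Sum.inr ⟨b3, hb3⟩ : {x : VA // x ≠ a} ⊕ {y : VB // y ≠ b})) := by
  have hca : Fintype.card {x : VA // x ≠ a} = Fintype.card VA - 1 := by simp
  have hcb : Fintype.card {y : VB // y ≠ b} = Fintype.card VB - 1 := by simp
  have hposA : 0 < Fintype.card VA := Fintype.card_pos_iff.mpr ⟨a⟩
  have hposB : 0 < Fintype.card VB := Fintype.card_pos_iff.mpr ⟨b⟩
  refine ⟨by rw [Fintype.card_sum, hca, hcb]; omega, ?_⟩
  rintro P ⟨⟨hpath, hdisj⟩, hsub, hcover⟩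
  by_contra hno
  have haa1 : A.Adj a a1 := by
    have : a1 ∈ A.neighborSet a := by simp [hNa]
    exact this
  have hcross : ∀ p ∈ P, ∀ x y, s(Sum.inl x, Sum.inr y) ∈ pEdges p →
      x = ⟨a1, ha1⟩ ∧ y.1 = b1 := by
    intro p hp x y hxy
    have hadj : (glueV A B a b a1 a2 a3 b1 b2 b3).Adj (Sum.inl x) (Sum.inr y) := by
      obtain ⟨-, -, -, h4, h5⟩ := hpath p hp
      rcases hxy with h | h
      · rwa [← SimpleGraph.mem_edgeSet, h]
      · rwa [← SimpleGraph.mem_edgeSet, Set.mem_singleton_iff.mp h]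
    have hy : Sum.inr y ∈ pVerts p := by
      simp only [pEdges, Set.mem_insert_iff, Set.mem_singleton_iff, Sym2.eq_iff] at hxy
      simp only [pVerts, Set.mem_insert_iff, Set.mem_singleton_iff]
      tauto
    rcases glueV_adj_inl_inr.mp hadj with ⟨hx, hy⟩ | ⟨-, hy2⟩ | ⟨hx3, hy3⟩
    · exact ⟨Subtype.ext hx, hy⟩
    · exact absurd (congrArg Sum.inr (Subtype.ext hy2)) (hsub p hp hy)
    · refine absurd ⟨p, hp, ?_⟩ hno
      obtain rfl : x = ⟨a3, ha3⟩ := Subtype.ext hx3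
      obtain rfl : y = ⟨b3, hb3⟩ := Subtype.ext hy3
      exact hxy
  have hcases := fun p hp => path_cases ha1 haa1 (hpath p hp) (hcross p hp)
  have hcoverL : ∀ x, ∃ p ∈ P, Sum.inl x ∈ pVerts p := fun x => hcover _ (by simp)
  have hsum := sum_card_leftVerts hdisj hcoverL
  rw [hca] at hsum
  obtain ⟨p₀, hp₀, hap₀⟩ := hcoverL ⟨a1, ha1⟩
  have hrest : ∀ p ∈ P, p ≠ p₀ → leftVerts p = ∅ ∨
      ((leftVerts p).card = 3 ∧ IsPathL A (mapPath (contractSide a b) p) ∧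
        a ∉ pVerts (mapPath (contractSide a b) p)) := by
    intro p hp hne
    have hn := fun h => Set.disjoint_left.mp (hdisj p hp p₀ hp₀ hne) h hap₀
    rcases hcases p hp with h | h | h | h
    · exact .inl h
    · exact .inr h
    · exact absurd h.2 hn
    · exact absurd h.2.1 hn
  have hdvd : 3 ∣ ∑ p ∈ P.erase p₀, (leftVerts p).card := by
    refine Finset.dvd_sum fun p hp => ?_
    rcases hrest p (Finset.mem_of_mem_erase hp) (Finset.ne_of_mem_erase hp) with h | h
    · simp [h]
    · simp [h.1]
  rw [← Finset.add_sum_erase P _ hp₀] at hsum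
  obtain ⟨hpathA₀, ha₀, hedge₀⟩ : IsPathL A (mapPath (contractSide a b) p₀) ∧
      a ∈ pVerts (mapPath (contractSide a b) p₀) ∧
      s(a, a1) ∈ pEdges (mapPath (contractSide a b) p₀) := by
    rcases hcases p₀ hp₀ with h | h | h | h
    · rw [h, Finset.card_empty] at hsum
      omega
    · omega
    · omega
    · exact h.2.2
  have hlift : ∀ p, ∀ v ∈ pVerts (mapPath (contractSide a b) p), ∀ hv : v ≠ a,
      Sum.inl ⟨v, hv⟩ ∈ pVerts p := by
    intro p v hvp hv
    obtain ⟨u, hu, rfl⟩ := mem_pVerts_mapPath.mp hvp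
    rcases u with x | y
    · exact hu
    · exact absurd rfl hv
  refine hA ⟨(P.filter fun p => leftVerts p ≠ ∅).image (mapPath (contractSide a b)),
    ⟨⟨?_, ?_⟩, fun _ _ => Set.subset_univ _, ?_⟩, _, ?_, hedge₀⟩
  · simp only [Finset.forall_mem_image, Finset.mem_filter]
    rintro p ⟨hp, hne⟩
    by_cases h : p = p₀
    · exact h ▸ hpathA₀
    · exact ((hrest p hp h).resolve_left hne).2.1
  · simp only [Finset.forall_mem_image, Finset.mem_filter]
    rintro p ⟨hp, hpne⟩ q ⟨hq, hqne⟩ hpq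
    have hne : p ≠ q := fun h => hpq (h ▸ rfl)
    rw [Set.disjoint_left]
    intro v hvp hvq
    by_cases hv : v = a
    · subst hv
      have honly : ∀ r ∈ P, leftVerts r ≠ ∅ →
          v ∈ pVerts (mapPath (contractSide v b) r) → r = p₀ := by
        intro r hr hrne hvr
        by_contra h
        exact ((hrest r hr h).resolve_left hrne).2.2 hvr
      exact hne ((honly p hp hpne hvp).trans (honly q hq hqne hvq).symm)
    · exact Set.disjoint_left.mp (hdisj p hp q hq hne) (hlift p v hvp hv) (hlift q v hvq hv)
  · intro v _
    simp only [Finset.exists_mem_image, Finset.mem_filter]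
    by_cases hv : v = a
    · subst hv
      exact ⟨p₀, ⟨hp₀, Finset.ne_empty_of_mem (mem_leftVerts.mpr ⟨hap₀, rfl⟩)⟩, ha₀⟩
    · obtain ⟨p, hp, hvp⟩ := hcoverL ⟨v, hv⟩
      exact ⟨p, ⟨hp, Finset.ne_empty_of_mem (mem_leftVerts.mpr ⟨hvp, rfl⟩)⟩,
        mem_pVerts_mapPath.mpr ⟨_, hvp, rfl⟩⟩
  · exact Finset.mem_image_of_mem _ (Finset.mem_filter.mpr
      ⟨hp₀, Finset.ne_empty_of_mem (mem_leftVerts.mpr ⟨hap₀, rfl⟩)⟩)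
end
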